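/- arXiv:1608.07993 — 2 statements merged into one kernel-verified Lean document; each statement's English description precedes it below -/
import Mathlib

section
/- Let (P, Φ₀) and (Q, Ψ₀) be rooted abstract polytopes of rank 3. On the set of pairs (Φ, Ψ), where Φ is a flag of P and Ψ is a flag of Q, define for each i ∈ {0,1,2} the involution σ_i(Φ, Ψ) = (Φ^i, Ψ^i). Let M be the orbit of (Φ₀, Ψ₀) under the group generated by σ₀, σ₁, σ₂ (the mix of the two rooted polytopes). Then M is polytopal: there exist an abstract polytope R of rank 3 and a bijection f from M onto the set of flags of R such that f(σ_i(x)) = (f(x))^i for every x ∈ M and every i ∈ {0,1,2}. -/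
/-- `IsAbstractPolytope n P rk` says that the partially ordered set `P`, equipped with the
strictly monotone rank function `rk` taking values in `{-1, 0, …, n}`, is an abstract
polytope of rank `n`:  it has a unique minimal face of rank `-1` and a unique maximal face of
rank `n`; every flag (maximal chain) contains exactly one face of each rank; the diamond
condition holds; and it is strongly connected. -/
structure IsAbstractPolytope (n : ℕ) (P : Type*) [PartialOrder P] (rk : P → ℤ) : Prop where
  /-- The rank function is strictly monotone. -/
  strictMono : StrictMono rk
  /-- There is a (necessarily unique) minimal face, of rank `-1`. -/
  exists_bot : ∃ B : P, rk B = -1 ∧ ∀ F : P, B ≤ F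
  /-- There is a (necessarily unique) maximal face, of rank `n`. -/
  exists_top : ∃ T : P, rk T = (n : ℤ) ∧ ∀ F : P, F ≤ T
  /-- Every flag contains exactly one face of each rank `-1 ≤ j ≤ n`
  (hence `n + 2` faces in all). -/
  flag_ranks : ∀ (Φ : Flag P) (j : ℤ), -1 ≤ j → j ≤ (n : ℤ) →
    ∃! F : P, F ∈ Φ ∧ rk F = j
  /-- Diamond condition: if `F < G` with `rk G = rk F + 2`, there are exactly two faces
  strictly between `F` and `G`. -/
  diamond : ∀ F G : P, F < G → rk G = rk F + 2 →
    ∃ H₁ H₂ : P, H₁ ≠ H₂ ∧ {H : P | F < H ∧ H < G} = {H₁, H₂}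
  /-- Strong connectivity: if `F < G` with `rk G - rk F ≥ 3`, any two faces strictly between
  `F` and `G` are joined by a sequence of faces strictly between `F` and `G` in which
  consecutive members are comparable. -/
  connected : ∀ F G H H' : P, F < G → rk F + 3 ≤ rk G →
    F < H → H < G → F < H' → H' < G →
    Relation.ReflTransGen
      (fun A B : P => F < A ∧ A < G ∧ F < B ∧ B < G ∧ (A ≤ B ∨ B ≤ A)) H H'

/-- Two flags are `i`-adjacent if they are distinct but agree in every face whose rank is
not `i` (so they differ exactly in their face of rank `i`). -/
def IAdjacent {P : Type*} [PartialOrder P] (rk : P → ℤ) (i : ℤ) (Φ Ψ : Flag P) : Prop :=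
  Φ ≠ Ψ ∧ ∀ F : P, rk F ≠ i → (F ∈ Φ ↔ F ∈ Ψ)

/-- One step of the mix of two rooted rank-3 polytopes: apply the `i`-adjacency involutions
`σ_i = (fP i, fQ i)` simultaneously in both coordinates, for some `i ∈ {0, 1, 2}`. -/
def MixStep {P Q : Type*} [PartialOrder P] [PartialOrder Q]
    (fP : Fin 3 → Flag P → Flag P) (fQ : Fin 3 → Flag Q → Flag Q)
    (a b : Flag P × Flag Q) : Prop :=
  ∃ i : Fin 3, b = (fP i a.1, fQ i a.2)

/-- The mix of two rooted polytopes: the orbit of the pair of base flags `(Φ₀, Ψ₀)` under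
the group generated by the involutions `σ₀, σ₁, σ₂` (equivalently, the closure of
`(Φ₀, Ψ₀)` under the maps `σ_i`, which are involutions). -/
def MixOrbit {P Q : Type*} [PartialOrder P] [PartialOrder Q]
    (fP : Fin 3 → Flag P → Flag P) (fQ : Fin 3 → Flag Q → Flag Q)
    (Φ₀ : Flag P) (Ψ₀ : Flag Q) : Set (Flag P × Flag Q) :=
  {x | Relation.ReflTransGen (MixStep fP fQ) (Φ₀, Ψ₀) x}

/-- `ColorReach s J x y` says that `y` is reached from `x` by applying maps `s j` with `j ∈ J`. -/
def ColorReach {X : Type*} (s : Fin 3 → X → X) (J : Set (Fin 3)) : X → X → Prop :=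
  Relation.ReflTransGen fun x y => ∃ j ∈ J, y = s j x

/-- Ranks `-1, …, 3` are indexed by `Fin 5`, so colour `j` moves the face of index `j + 1`.
These are the colours that fix the face of index `r`. -/
def offRank (r : Fin 5) : Set (Fin 3) := {j | j.castSucc.succ ≠ r}

namespace ColorReach

variable {X Y : Type*} {s : Fin 3 → X → X} {J K : Set (Fin 3)} {x y z : X}

theorem refl (x : X) : ColorReach s J x x := Relation.ReflTransGen.refl

theorem single {j : Fin 3} (hj : j ∈ J) (x : X) : ColorReach s J x (s j x) :=
  Relation.ReflTransGen.single ⟨j, hj, rfl⟩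

theorem trans (h : ColorReach s J x y) (h' : ColorReach s J y z) : ColorReach s J x z :=
  Relation.ReflTransGen.trans h h'

theorem symm (hs : ∀ i x, s i (s i x) = x) (h : ColorReach s J x y) : ColorReach s J y x := by
  induction h with
  | refl => exact refl _
  | @tail w _ _ h ih =>
    obtain ⟨j, hj, rfl⟩ := h
    have := single (s := s) hj (s j w)
    rw [hs] at this
    exact this.trans ih

theorem mono (hJK : J ⊆ K) (h : ColorReach s J x y) : ColorReach s K x y := by
  induction h with
  | refl => exact refl _
  | tail _ h ih =>
    obtain ⟨j, hj, rfl⟩ := h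
    exact ih.trans (single (hJK hj) _)

theorem apply_eq {c : X → Y} (hc : ∀ j ∈ J, ∀ x, c (s j x) = c x) (h : ColorReach s J x y) :
    c y = c x := by
  induction h with
  | refl => rfl
  | tail _ h ih =>
    obtain ⟨j, hj, rfl⟩ := h
    rw [hc j hj, ih]

theorem map {t : Fin 3 → Y → Y} {e : X → Y} (he : ∀ j x, e (s j x) = t j (e x))
    (h : ColorReach s J x y) : ColorReach t J (e x) (e y) := by
  induction h with
  | refl => exact refl _
  | tail _ h ih =>
    obtain ⟨j, hj, rfl⟩ := h
    rw [he]
    exact ih.trans (single hj _)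

end ColorReach

/-- A connected `3`-maniplex satisfying the intersection conditions on its colour orbits that
make it the flag graph of a polyhedron. -/
structure PolyhedralManiplex (X : Type*) where
  /-- The adjacency involutions. -/
  s : Fin 3 → X → X
  invol : ∀ i x, s i (s i x) = x
  comm : ∀ x, s 0 (s 2 x) = s 2 (s 0 x)
  conn : ∀ x y, ColorReach s Set.univ x y
  not_reach : ∀ i x, ¬ ColorReach s (offRank i.castSucc.succ) x (s i x)
  inter : ∀ x y, ColorReach s (offRank 1) x y → ColorReach s (offRank 3) x y → y = x ∨ y = s 1 x

namespace PolyhedralManiplex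

variable {X : Type*} (M : PolyhedralManiplex X)

/-- Pairs `(r, x)` and `(t, y)` represent the same face when `r = t` and the colours other than
the one moving rank `r` connect `x` to `y`. -/
def faceSetoid : Setoid (Fin 5 × X) where
  r a b := a.1 = b.1 ∧ ColorReach M.s (offRank a.1) a.2 b.2
  iseqv :=
    { refl := fun _ => ⟨rfl, .refl _⟩
      symm := fun ⟨h, h'⟩ => ⟨h.symm, h ▸ h'.symm M.invol⟩
      trans := fun ⟨h, h'⟩ ⟨k, k'⟩ => ⟨h.trans k, h'.trans (h ▸ k')⟩ }

/-- The faces of a polyhedral maniplex. -/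
def Face : Type _ := Quotient M.faceSetoid

/-- The face of rank index `r` of the flag `x`. -/
def face (r : Fin 5) (x : X) : M.Face := Quotient.mk M.faceSetoid (r, x)

/-- The rank index of a face. -/
def rank : M.Face → Fin 5 := Quotient.lift Prod.fst fun _ _ h => h.1

@[simp] theorem rank_face (r : Fin 5) (x : X) : M.rank (M.face r x) = r := rfl

theorem exists_face_eq (F : M.Face) : ∃ x, M.face (M.rank F) x = F := by
  induction F using Quotient.inductionOn with
  | h a => exact ⟨a.2, rfl⟩

theorem face_eq_iff {r : Fin 5} {x y : X} :
    M.face r x = M.face r y ↔ ColorReach M.s (offRank r) x y :=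
  ⟨fun h => (Quotient.exact h).2, fun h => Quotient.sound ⟨rfl, h⟩⟩

theorem face_s {r : Fin 5} {j : Fin 3} (h : j.castSucc.succ ≠ r) (x : X) :
    M.face r (M.s j x) = M.face r x :=
  (M.face_eq_iff.2 (.single h x)).symm

theorem face_s_ne (i : Fin 3) (x : X) :
    M.face i.castSucc.succ x ≠ M.face i.castSucc.succ (M.s i x) :=
  fun h => M.not_reach i x (M.face_eq_iff.1 h)

theorem face_zero (x y : X) : M.face 0 x = M.face 0 y :=
  M.face_eq_iff.2 ((M.conn x y).mono fun _ _ => Fin.succ_ne_zero _)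

theorem face_four (x y : X) : M.face 4 x = M.face 4 y :=
  M.face_eq_iff.2 ((M.conn x y).mono fun j _ => by revert j; simp [offRank]; decide)

theorem edge_cases {x y : X} (h : M.face 2 x = M.face 2 y) :
    y = x ∨ y = M.s 0 x ∨ y = M.s 2 x ∨ y = M.s 0 (M.s 2 x) := by
  induction M.face_eq_iff.1 h with
  | refl => exact .inl rfl
  | tail h' hj ih =>
    obtain ⟨j, hj, rfl⟩ := hj
    have h1 := M.invol
    have h2 := M.comm
    rcases ih (M.face_eq_iff.2 h') with rfl | rfl | rfl | rfl <;> fin_cases j <;>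
      simp [offRank] at hj ⊢ <;> grind

/-- Two flags sharing a face can be amalgamated below and above that face. -/
theorem exists_amalgam {i j k : Fin 5} (hij : i ≤ j) (hjk : j ≤ k) {x y : X}
    (h : M.face j x = M.face j y) :
    ∃ z, M.face i z = M.face i x ∧ M.face j z = M.face j x ∧ M.face k z = M.face k y := by
  have key : i = 0 ∨ k = 4 ∨ i = j ∨ j = k ∨ (i = 1 ∧ j = 2 ∧ k = 3) := by
    clear h
    revert i j k; decide
  rcases key with rfl | rfl | rfl | rfl | ⟨rfl, rfl, rfl⟩
  · exact ⟨y, M.face_zero _ _, h.symm, rfl⟩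
  · exact ⟨x, rfl, rfl, M.face_four _ _⟩
  · exact ⟨y, h.symm, h.symm, rfl⟩
  · exact ⟨x, rfl, rfl, h⟩
  · have h0 : ∀ x, M.face 3 (M.s 0 x) = M.face 3 x := M.face_s (by decide)
    have h2 : ∀ x, M.face 1 (M.s 2 x) = M.face 1 x := M.face_s (by decide)
    have h2' : ∀ x, M.face 2 (M.s 2 x) = M.face 2 x := M.face_s (by decide)
    rcases M.edge_cases h with rfl | rfl | rfl | rfl
    · exact ⟨y, rfl, rfl, rfl⟩
    · exact ⟨x, rfl, rfl, (h0 x).symm⟩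
    · exact ⟨M.s 2 x, h2 x, h2' x, rfl⟩
    · exact ⟨M.s 2 x, h2 x, h2' x, (h0 _).symm⟩

instance : PartialOrder M.Face where
  le F G := M.rank F ≤ M.rank G ∧ ∃ x, M.face (M.rank F) x = F ∧ M.face (M.rank G) x = G
  le_refl F := ⟨le_rfl, (M.exists_face_eq F).imp fun _ h => ⟨h, h⟩⟩
  le_trans := by
    rintro F G H ⟨hFG, x, hF, hG⟩ ⟨hGH, y, hG', hH⟩
    obtain ⟨z, h1, -, h3⟩ := M.exists_amalgam hFG hGH (hG.trans hG'.symm)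
    exact ⟨hFG.trans hGH, z, h1.trans hF, h3.trans hH⟩
  le_antisymm := by
    rintro F G ⟨h, x, hF, hG⟩ ⟨h', -⟩
    rw [← hF, ← hG, le_antisymm h h']

theorem face_le_face {r t : Fin 5} (h : r ≤ t) (x : X) : M.face r x ≤ M.face t x :=
  ⟨h, x, rfl, rfl⟩

theorem eq_of_le_of_rank_eq {F G : M.Face} (h : F ≤ G) (hr : M.rank F = M.rank G) : F = G := by
  obtain ⟨-, x, hF, hG⟩ := h
  rw [← hF, ← hG, hr]

theorem rank_strictMono : StrictMono M.rank := fun _ _ h =>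
  lt_of_le_of_ne h.le.1 fun hr => h.ne (M.eq_of_le_of_rank_eq h.le hr)

theorem face_lt_face {r t : Fin 5} (h : r < t) (x : X) : M.face r x < M.face t x :=
  lt_of_le_of_ne (M.face_le_face h.le x) fun e => h.ne (congrArg M.rank e)

theorem exists_common_face {F H G : M.Face} (h : F ≤ H) (h' : H ≤ G) :
    ∃ x, M.face (M.rank F) x = F ∧ M.face (M.rank H) x = H ∧ M.face (M.rank G) x = G := by
  obtain ⟨hFH, x, hF, hH⟩ := h
  obtain ⟨hHG, y, hH', hG⟩ := h'
  obtain ⟨z, h1, h2, h3⟩ := M.exists_amalgam hFH hHG (hH.trans hH'.symm)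
  exact ⟨z, h1.trans hF, h2.trans hH, h3.trans hG⟩

/-- The flag of faces determined by a point of the maniplex. -/
def flagOf (x : X) : Flag M.Face where
  carrier := Set.range fun r => M.face r x
  Chain' := by
    rintro _ ⟨r, rfl⟩ _ ⟨t, rfl⟩ -
    exact (le_total r t).imp (M.face_le_face · x) (M.face_le_face · x)
  max_chain' := by
    intro C hC hle
    refine hle.antisymm fun F hF => ⟨M.rank F, ?_⟩
    rcases hC.total (hle ⟨M.rank F, rfl⟩) hF with h | h
    · exact M.eq_of_le_of_rank_eq h rfl
    · exact (M.eq_of_le_of_rank_eq h rfl).symm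

theorem mem_flagOf {x : X} {F : M.Face} : F ∈ M.flagOf x ↔ M.face (M.rank F) x = F :=
  ⟨by rintro ⟨r, rfl⟩; rfl, fun h => ⟨_, h⟩⟩

theorem flagOf_injective : Function.Injective M.flagOf := by
  intro x y h
  have key (r : Fin 5) : M.face r x = M.face r y := by
    have : M.face r x ∈ M.flagOf y := h ▸ ⟨r, rfl⟩
    exact (M.mem_flagOf.1 this).symm
  rcases M.inter x y (M.face_eq_iff.1 (key 1)) (M.face_eq_iff.1 (key 3)) with rfl | rfl
  · rfl
  · exact absurd (key 2) (M.face_s_ne 1 x)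

theorem exists_chain_pair [Nonempty X] {C : Set M.Face} (hC : IsChain (· ≤ ·) C) (r t : Fin 5) :
    ∃ x, ∀ F ∈ C, M.rank F = r ∨ M.rank F = t → M.face (M.rank F) x = F := by
  have huniq {F G : M.Face} (hF : F ∈ C) (hG : G ∈ C) (h : M.rank F = M.rank G) : F = G := by
    rcases hC.total hF hG with h' | h'
    · exact M.eq_of_le_of_rank_eq h' h
    · exact (M.eq_of_le_of_rank_eq h' h.symm).symm
  by_cases hr : ∃ F ∈ C, M.rank F = r
  · obtain ⟨F, hF, rfl⟩ := hr
    by_cases ht : ∃ G ∈ C, M.rank G = t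
    · obtain ⟨G, hG, rfl⟩ := ht
      obtain ⟨x, hxF, hxG⟩ : ∃ x, M.face (M.rank F) x = F ∧ M.face (M.rank G) x = G := by
        rcases hC.total hF hG with ⟨-, h⟩ | ⟨-, x, h, h'⟩
        · exact h
        · exact ⟨x, h', h⟩
      refine ⟨x, fun H hH hr => ?_⟩
      rcases hr with hr | hr
      · rwa [huniq hH hF hr]
      · rwa [huniq hH hG hr]
    · obtain ⟨x, hx⟩ := M.exists_face_eq F
      refine ⟨x, fun H hH hr => ?_⟩
      rcases hr with hr | hr
      · rwa [huniq hH hF hr]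
      · exact absurd ⟨H, hH, hr⟩ ht
  · by_cases ht : ∃ G ∈ C, M.rank G = t
    · obtain ⟨G, hG, rfl⟩ := ht
      obtain ⟨x, hx⟩ := M.exists_face_eq G
      refine ⟨x, fun H hH hr' => ?_⟩
      rcases hr' with hr' | hr'
      · exact absurd ⟨H, hH, hr'⟩ hr
      · rwa [huniq hH hG hr']
    · exact ⟨Classical.arbitrary X, fun H hH h =>
        (h.elim (fun h => hr ⟨H, hH, h⟩) fun h => ht ⟨H, hH, h⟩).elim⟩

theorem flagOf_surjective [Nonempty X] : Function.Surjective M.flagOf := by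
  intro C
  suffices ∃ x, ∀ F ∈ C, M.face (M.rank F) x = F by
    obtain ⟨x, hx⟩ := this
    have hsub : (C : Set M.Face) ⊆ M.flagOf x := fun F hF => M.mem_flagOf.2 (hx F hF)
    exact ⟨x, (Flag.ext (C.max_chain' (M.flagOf x).Chain' hsub)).symm⟩
  have hrank (F : M.Face) (x : X) (h : M.rank F = 1 ∨ M.rank F = 2 ∨ M.rank F = 3 →
      M.face (M.rank F) x = F) : M.face (M.rank F) x = F := by
    obtain ⟨y, hy⟩ := M.exists_face_eq F
    have : M.rank F = 0 ∨ M.rank F = 4 ∨ M.rank F = 1 ∨ M.rank F = 2 ∨ M.rank F = 3 := by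
      generalize M.rank F = r
      revert r; decide
    rcases this with h0 | h4 | h'
    · rw [← hy, rank_face, h0]; exact M.face_zero _ _
    · rw [← hy, rank_face, h4]; exact M.face_four _ _
    · exact h h'
  by_cases hE : ∃ E ∈ C, M.rank E = 2
  · obtain ⟨E, hE, h2⟩ := hE
    obtain ⟨x, hx⟩ := M.exists_chain_pair C.Chain' 1 2
    obtain ⟨y, hy⟩ := M.exists_chain_pair C.Chain' 2 3
    have hxy : M.face 2 x = M.face 2 y := by
      rw [← h2, hx E hE (.inr h2), hy E hE (.inl h2)]
    obtain ⟨z, h1, h2, h3⟩ := M.exists_amalgam (i := 1) (k := 3) (by decide) (by decide) hxy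
    refine ⟨z, fun F hF => hrank F z ?_⟩
    rintro (h | h | h)
    · rw [← hx F hF (.inl h), rank_face, h, h1]
    · rw [← hx F hF (.inr h), rank_face, h, h2]
    · rw [← hy F hF (.inr h), rank_face, h, h3]
  · obtain ⟨x, hx⟩ := M.exists_chain_pair C.Chain' 1 3
    refine ⟨x, fun F hF => hrank F x ?_⟩
    rintro (h | h | h)
    · exact hx F hF (.inl h)
    · exact absurd ⟨F, hF, h⟩ hE
    · exact hx F hF (.inr h)

/-- The rank function of the polytope of faces, with values in `{-1, …, 3}`. -/
def rk (F : M.Face) : ℤ := ((M.rank F : ℕ) : ℤ) - 1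

theorem adjacent_flagOf (i : Fin 3) (x : X) :
    IAdjacent M.rk (i : ℤ) (M.flagOf x) (M.flagOf (M.s i x)) := by
  refine ⟨fun h => M.face_s_ne i x (congrArg _ (M.flagOf_injective h)), fun F hF => ?_⟩
  rw [mem_flagOf, mem_flagOf, M.face_s]
  rintro h
  apply hF
  simp [rk, ← h]

/-- Flags sharing the faces of index `i` and `i + 2` have one of two faces of index `i + 1`. -/
theorem face_mid_cases (i : Fin 3) {x y : X}
    (h : M.face i.castSucc.castSucc x = M.face i.castSucc.castSucc y)
    (h' : M.face i.succ.succ x = M.face i.succ.succ y) :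
    M.face i.castSucc.succ y = M.face i.castSucc.succ x ∨
      M.face i.castSucc.succ y = M.face i.castSucc.succ (M.s i x) := by
  have h02 : ∀ x, M.face 3 (M.s 0 x) = M.face 3 x := M.face_s (by decide)
  have h20 : ∀ x, M.face 1 (M.s 2 x) = M.face 1 x := M.face_s (by decide)
  fin_cases i
  · change M.face 1 y = M.face 1 x ∨ M.face 1 y = M.face 1 (M.s 0 x)
    rcases M.edge_cases h' with rfl | rfl | rfl | rfl
    · exact .inl rfl
    · exact .inr rfl
    · exact .inl (h20 x)
    · exact .inr (by rw [M.comm, h20])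
  · change M.face 2 y = M.face 2 x ∨ M.face 2 y = M.face 2 (M.s 1 x)
    rcases M.inter x y (M.face_eq_iff.1 h) (M.face_eq_iff.1 h') with rfl | rfl
    · exact .inl rfl
    · exact .inr rfl
  · change M.face 3 y = M.face 3 x ∨ M.face 3 y = M.face 3 (M.s 2 x)
    rcases M.edge_cases h with rfl | rfl | rfl | rfl
    · exact .inl rfl
    · exact .inl (h02 x)
    · exact .inr rfl
    · exact .inr (h02 _)

theorem diamond {F G : M.Face} (hFG : F < G) (hrk : M.rk G = M.rk F + 2) :
    ∃ H₁ H₂ : M.Face, H₁ ≠ H₂ ∧ {H : M.Face | F < H ∧ H < G} = {H₁, H₂} := by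
  obtain ⟨-, x, hF, hG⟩ := hFG.le
  obtain ⟨i, hi, hi'⟩ : ∃ i : Fin 3, M.rank F = i.castSucc.castSucc ∧ M.rank G = i.succ.succ := by
    refine ⟨⟨M.rank F, ?_⟩, ?_, ?_⟩
    · simp only [rk] at hrk; omega
    · ext; simp
    · ext; simp only [rk] at hrk; simp; omega
  rw [hi] at hF
  rw [hi'] at hG
  have hlt : i.castSucc.castSucc < i.castSucc.succ := by simp [Fin.lt_def]
  have hlt' : i.castSucc.succ < i.succ.succ := by simp [Fin.lt_def]
  have hF' : M.face i.castSucc.castSucc (M.s i x) = F := by rw [M.face_s hlt.ne', hF]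
  have hG' : M.face i.succ.succ (M.s i x) = G := by rw [M.face_s hlt'.ne, hG]
  refine ⟨_, _, M.face_s_ne i x, Set.ext fun H => ⟨?_, ?_⟩⟩
  · rintro ⟨hFH, hHG⟩
    obtain ⟨y, h1, h2, h3⟩ := M.exists_common_face hFH.le hHG.le
    have hH : M.rank H = i.castSucc.succ := by
      have := M.rank_strictMono hFH
      have := M.rank_strictMono hHG
      simp only [hi, hi', Fin.lt_def, Fin.ext_iff, Fin.val_castSucc, Fin.val_succ] at *
      omega
    rw [hi] at h1
    rw [hi'] at h3
    rw [← h2, hH]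
    exact M.face_mid_cases i (hF.trans h1.symm) (hG.trans h3.symm)
  · rintro (rfl | rfl)
    · exact ⟨hF ▸ M.face_lt_face hlt x, hG ▸ M.face_lt_face hlt' x⟩
    · exact ⟨hF' ▸ M.face_lt_face hlt _, hG' ▸ M.face_lt_face hlt' _⟩

/-- Flags sharing the faces of index `r` and `t`, at least three ranks apart, are connected by
the colours strictly in between. -/
theorem colorReach_between {r t : Fin 5} (hrt : (r : ℕ) + 3 ≤ t) {x y : X}
    (hr : M.face r x = M.face r y) (ht : M.face t x = M.face t y) :
    ColorReach M.s {j | r < j.castSucc.succ ∧ j.castSucc.succ < t} x y := by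
  have : (r = 0 ∧ t = 3) ∨ (r = 1 ∧ t = 4) ∨ (r = 0 ∧ t = 4) := by
    clear hr ht
    revert r t; decide
  rcases this with ⟨rfl, rfl⟩ | ⟨rfl, rfl⟩ | ⟨rfl, rfl⟩
  · refine (M.face_eq_iff.1 ht).mono fun j => ?_
    simp only [offRank, Set.mem_ofPred_eq]
    revert j; decide
  · refine (M.face_eq_iff.1 hr).mono fun j => ?_
    simp only [offRank, Set.mem_ofPred_eq]
    revert j; decide
  · refine (M.conn x y).mono fun j _ => ?_
    simp only [Set.mem_ofPred_eq]
    revert j; decide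

theorem connected {F G H H' : M.Face} (hrk : M.rk F + 3 ≤ M.rk G)
    (hFH : F < H) (hHG : H < G) (hFH' : F < H') (hHG' : H' < G) :
    Relation.ReflTransGen
      (fun A B : M.Face => F < A ∧ A < G ∧ F < B ∧ B < G ∧ (A ≤ B ∨ B ≤ A)) H H' := by
  obtain ⟨y, y1, y2, y3⟩ := M.exists_common_face hFH.le hHG.le
  obtain ⟨z, z1, z2, z3⟩ := M.exists_common_face hFH'.le hHG'.le
  have hrt : (M.rank F : ℕ) + 3 ≤ M.rank G := by simp only [rk] at hrk; omega
  have hyz := M.colorReach_between hrt (y1.trans z1.symm) (y3.trans z3.symm)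
  have step {w : X} (h : M.face (M.rank F) w = F) (h' : M.face (M.rank G) w = G) {a b : Fin 5}
      (ha : M.rank F < a) (ha' : a < M.rank G) (hb : M.rank F < b) (hb' : b < M.rank G) :
      F < M.face a w ∧ M.face a w < G ∧ F < M.face b w ∧ M.face b w < G ∧
        (M.face a w ≤ M.face b w ∨ M.face b w ≤ M.face a w) := by
    have h1 := M.face_lt_face ha w
    have h2 := M.face_lt_face ha' w
    have h3 := M.face_lt_face hb w
    have h4 := M.face_lt_face hb' w
    rw [h] at h1 h3
    rw [h'] at h2 h4
    exact ⟨h1, h2, h3, h4, (le_total a b).imp (M.face_le_face · w) (M.face_le_face · w)⟩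
  suffices key : (M.face (M.rank F) z = F ∧ M.face (M.rank G) z = G) ∧
      ∀ b, M.rank F < b → b < M.rank G → Relation.ReflTransGen
        (fun A B : M.Face => F < A ∧ A < G ∧ F < B ∧ B < G ∧ (A ≤ B ∨ B ≤ A)) H (M.face b z) by
    have := key.2 _ (M.rank_strictMono hFH') (M.rank_strictMono hHG')
    rwa [z2] at this
  clear z1 z2 z3
  induction hyz with
  | refl =>
    refine ⟨⟨y1, y3⟩, fun b hb hb' => .single ?_⟩
    have := step y1 y3 (M.rank_strictMono hFH) (M.rank_strictMono hHG) hb hb'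
    rwa [y2] at this
  | @tail w _ _ h ih =>
    obtain ⟨j, ⟨hj, hj'⟩, rfl⟩ := h
    obtain ⟨⟨hw, hw'⟩, ih⟩ := ih
    have hs : M.face (M.rank F) (M.s j w) = F := by rw [M.face_s hj.ne', hw]
    have hs' : M.face (M.rank G) (M.s j w) = G := by rw [M.face_s hj'.ne, hw']
    obtain ⟨c, hc, hc', hcj⟩ : ∃ c, M.rank F < c ∧ c < M.rank G ∧ j.castSucc.succ ≠ c := by
      generalize M.rank F = r at *
      generalize M.rank G = t at *
      clear * - hrt
      revert r t j; decide
    refine ⟨⟨hs, hs'⟩, fun b hb hb' => (ih c hc hc').tail ?_⟩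
    have := step hs hs' hc hc' hb hb'
    rwa [M.face_s hcj] at this

theorem isAbstractPolytope [Nonempty X] : IsAbstractPolytope 3 M.Face M.rk where
  strictMono F G h := by
    have := M.rank_strictMono h
    simp only [rk]
    omega
  exists_bot := by
    refine ⟨M.face 0 (Classical.arbitrary X), by simp [rk], fun F => ?_⟩
    obtain ⟨y, hy⟩ := M.exists_face_eq F
    rw [M.face_zero _ y, ← hy]
    exact M.face_le_face (Fin.zero_le _) y
  exists_top := by
    refine ⟨M.face 4 (Classical.arbitrary X), by simp [rk], fun F => ?_⟩
    obtain ⟨y, hy⟩ := M.exists_face_eq F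
    rw [M.face_four _ y, ← hy]
    exact M.face_le_face (Fin.le_last _) y
  flag_ranks Φ j hj hj' := by
    obtain ⟨x, rfl⟩ := M.flagOf_surjective Φ
    refine ⟨M.face ⟨(j + 1).toNat, by omega⟩ x, ⟨⟨_, rfl⟩, ?_⟩, ?_⟩
    · simp only [rk, rank_face]; omega
    · rintro F ⟨hF, hFj⟩
      rw [← M.mem_flagOf.1 hF]
      congr 1
      ext
      simp only [rk] at hFj
      simp only
      omega
  diamond _ _ := M.diamond
  connected _ _ _ _ _ := M.connected

end PolyhedralManiplex

/-- `c` describes each element of `X` by five faces, in the way flags of a polyhedron are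
described by their faces, with `f i` changing the face of index `i + 1` only. -/
structure IsFlagCoordinates {X P : Type*} (f : Fin 3 → X → X) (c : X → Fin 5 → P) : Prop where
  injective : Function.Injective c
  adj_of_ne : ∀ {i r}, i.castSucc.succ ≠ r → ∀ x, c (f i x) r = c x r
  adj_ne : ∀ i x, c (f i x) i.castSucc.succ ≠ c x i.castSucc.succ
  zero : ∀ x y, c x 0 = c y 0
  four : ∀ x y, c x 4 = c y 4
  mid_cases : ∀ i {x y}, c y i.castSucc.castSucc = c x i.castSucc.castSucc →
    c y i.succ.succ = c x i.succ.succ →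
    c y i.castSucc.succ = c x i.castSucc.succ ∨ c y i.castSucc.succ = c (f i x) i.castSucc.succ

namespace IsFlagCoordinates

variable {X P : Type*} {f : Fin 3 → X → X} {c : X → Fin 5 → P}

theorem ne_self (h : IsFlagCoordinates f c) (i : Fin 3) (x : X) : f i x ≠ x :=
  fun e => h.adj_ne i x (by rw [e])

theorem eq_or_eq (h : IsFlagCoordinates f c) (i : Fin 3) {x y : X}
    (hxy : ∀ r, i.castSucc.succ ≠ r → c y r = c x r) : y = x ∨ y = f i x := by
  have hlo : i.castSucc.succ ≠ i.castSucc.castSucc := by simp [Fin.ext_iff]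
  have hhi : i.castSucc.succ ≠ i.succ.succ := by simp [Fin.ext_iff]
  refine (h.mid_cases i (hxy _ hlo) (hxy _ hhi)).imp (fun e => ?_) fun e => ?_ <;>
    refine h.injective (funext fun r => ?_) <;> by_cases hr : i.castSucc.succ = r
  · rw [← hr, e]
  · exact hxy r hr
  · rw [← hr, e]
  · rw [h.adj_of_ne hr, hxy r hr]

theorem invol (h : IsFlagCoordinates f c) (i : Fin 3) : Function.Involutive (f i) := fun x =>
  (h.eq_or_eq i fun r hr => by rw [h.adj_of_ne hr, h.adj_of_ne hr]).resolve_right (h.ne_self i _)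

theorem comm (h : IsFlagCoordinates f c) (x : X) : f 0 (f 2 x) = f 2 (f 0 x) := by
  have h01 := h.adj_ne 0
  have h02 : ∀ x, c (f 0 x) 2 = c x 2 := h.adj_of_ne (by decide)
  have h03 : ∀ x, c (f 0 x) 3 = c x 3 := h.adj_of_ne (by decide)
  have h21 : ∀ x, c (f 2 x) 1 = c x 1 := h.adj_of_ne (by decide)
  have h22 : ∀ x, c (f 2 x) 2 = c x 2 := h.adj_of_ne (by decide)
  have h23 := h.adj_ne 2
  refine h.injective (funext fun r => ?_)
  have hr : r = 0 ∨ r = 1 ∨ r = 2 ∨ r = 3 ∨ r = 4 := by revert r; decide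
  rcases hr with rfl | rfl | rfl | rfl | rfl
  · exact h.zero _ _
  · rw [h21]
    refine (h.mid_cases 0 (h.zero _ _) ?_).resolve_left fun e => h01 (f 2 x) ?_
    · exact (h02 _).trans (h22 x)
    · exact e.trans (h21 x).symm
  · rw [h02, h22, h22, h02]
  · rw [h03]
    refine ((h.mid_cases 2 ?_ (h.four _ _)).resolve_left fun e => h23 (f 0 x) ?_).symm
    · exact (h22 _).trans (h02 x)
    · exact e.trans (h03 x).symm
  · exact h.four _ _

end IsFlagCoordinates

theorem IsAbstractPolytope.exists_isFlagCoordinates {P : Type*} [PartialOrder P] {rk : P → ℤ}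
    (hP : IsAbstractPolytope 3 P rk) {f : Fin 3 → Flag P → Flag P}
    (hf : ∀ (i : Fin 3) (Φ : Flag P), IAdjacent rk (i : ℤ) Φ (f i Φ)) :
    ∃ c : Flag P → Fin 5 → P, IsFlagCoordinates f c := by
  have hex (Φ : Flag P) (r : Fin 5) : ∃! F : P, F ∈ Φ ∧ rk F = (r : ℕ) - 1 :=
    hP.flag_ranks Φ _ (by omega) (by omega)
  choose c hc huniq using hex
  have hmem (Φ : Flag P) (F : P) : F ∈ Φ ↔ ∃ r, F = c Φ r := by
    refine ⟨fun hF => ?_, fun ⟨r, hr⟩ => hr ▸ (hc Φ r).1⟩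
    obtain ⟨B, hB, hB'⟩ := hP.exists_bot
    obtain ⟨T, hT, hT'⟩ := hP.exists_top
    have h1 := hP.strictMono.monotone (hB' F)
    have h2 := hP.strictMono.monotone (hT' F)
    refine ⟨⟨(rk F + 1).toNat, by omega⟩, huniq Φ _ F ⟨hF, ?_⟩⟩
    simp only
    omega
  have hinj : Function.Injective c := fun Φ Ψ h => SetLike.ext fun F => by
    rw [hmem, hmem, h]
  have hne {i : Fin 3} {r : Fin 5} (h : i.castSucc.succ ≠ r) (Φ : Flag P) :
      c (f i Φ) r = c Φ r := by
    refine (huniq (f i Φ) r _ ⟨((hf i Φ).2 _ ?_).1 (hc Φ r).1, (hc Φ r).2⟩).symm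
    rw [(hc Φ r).2]
    contrapose! h
    simp only [Fin.ext_iff, Fin.val_castSucc, Fin.val_succ]
    omega
  have hadj (i : Fin 3) (Φ : Flag P) : c (f i Φ) i.castSucc.succ ≠ c Φ i.castSucc.succ := by
    refine fun h => (hf i Φ).1 (hinj (funext fun r => ?_))
    by_cases hr : i.castSucc.succ = r
    · rw [← hr, h]
    · exact (hne hr Φ).symm
  have hlt {Φ : Flag P} {r t : Fin 5} (h : r < t) : c Φ r < c Φ t := by
    rcases Φ.Chain'.total (hc Φ r).1 (hc Φ t).1 with h' | h'
    · refine lt_of_le_of_ne h' fun e => ?_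
      have h1 := (hc Φ r).2
      rw [e, (hc Φ t).2] at h1
      omega
    · have h1 := hP.strictMono.monotone h'
      rw [(hc Φ r).2, (hc Φ t).2] at h1
      omega
  refine ⟨c, hinj, hne, hadj, fun Φ Ψ => ?_, fun Φ Ψ => ?_, fun i {Φ Ψ} hlo hhi => ?_⟩
  · obtain ⟨B, hB, hB'⟩ := hP.exists_bot
    have (Φ : Flag P) : c Φ 0 = B := by
      refine ((hB' _).eq_or_lt.resolve_right fun h => ?_).symm
      have h1 := hP.strictMono h
      rw [hB, (hc Φ 0).2] at h1
      simp at h1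
    rw [this, this]
  · obtain ⟨T, hT, hT'⟩ := hP.exists_top
    have (Φ : Flag P) : c Φ 4 = T := by
      refine (hT' _).eq_or_lt.resolve_right fun h => ?_
      have h1 := hP.strictMono h
      rw [hT, (hc Φ 4).2] at h1
      simp at h1
    rw [this, this]
  · have h1 : i.castSucc.castSucc < i.castSucc.succ := by simp [Fin.lt_def]
    have h2 : i.castSucc.succ < i.succ.succ := by simp [Fin.lt_def]
    obtain ⟨H₁, H₂, -, hH⟩ := hP.diamond (c Φ i.castSucc.castSucc) (c Φ i.succ.succ)
      (hlt (h1.trans h2)) (by rw [(hc Φ _).2, (hc Φ _).2]; simp; ring)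
    have hmid {Θ : Flag P} (hl : c Θ i.castSucc.castSucc = c Φ i.castSucc.castSucc)
        (hh : c Θ i.succ.succ = c Φ i.succ.succ) :
        c Θ i.castSucc.succ = H₁ ∨ c Θ i.castSucc.succ = H₂ := by
      have : c Θ i.castSucc.succ ∈ ({H₁, H₂} : Set P) := by
        rw [← hH, ← hl, ← hh]
        exact ⟨hlt h1, hlt h2⟩
      exact this
    have hx := hmid (Θ := Φ) rfl rfl
    have hy := hmid hlo hhi
    have hz := hmid (hne h1.ne' Φ) (hne h2.ne Φ)
    have hxz := hadj i Φ
    grind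

section Dihedral

variable {G : Type*} [Group G] {a b : G}

theorem mul_zpow_mul_of_involutive (ha : a * a = 1) (hb : b * b = 1) (k : ℤ) :
    a * (a * b) ^ k = (a * b) ^ (-k) * a := by
  have ha' : a⁻¹ = a := inv_eq_of_mul_eq_one_left ha
  have hb' : b⁻¹ = b := inv_eq_of_mul_eq_one_left hb
  have h : a * (a * b) * a⁻¹ = (a * b)⁻¹ := by
    rw [mul_inv_rev, ha', hb', ← mul_assoc, ha, one_mul]
  rw [zpow_neg, ← inv_zpow, ← h, conj_zpow, inv_mul_cancel_right]

theorem mul_zpow_mul_of_involutive' (ha : a * a = 1) (hb : b * b = 1) (k : ℤ) :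
    b * (a * b) ^ k = (a * b) ^ (-(k + 1)) * a := by
  rw [← mul_zpow_mul_of_involutive ha hb, add_comm, zpow_add, zpow_one, ← mul_assoc, ← mul_assoc,
    ha, one_mul]

/-- Reflections in a dihedral group generated by fixed-point-free involutions have no fixed
points. -/
theorem Equiv.Perm.zpow_mul_apply_ne {X : Type*} {a b : Equiv.Perm X} (ha : a * a = 1)
    (hb : b * b = 1) (ha' : ∀ x, a x ≠ x) (hb' : ∀ x, b x ≠ x) (k : ℤ) (x : X) :
    ((a * b) ^ k * a) x ≠ x := by
  intro h
  rcases Int.even_or_odd' k with ⟨m, rfl | rfl⟩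
  · refine ha' (((a * b) ^ (-m)) x) ?_
    rw [← Equiv.Perm.mul_apply, mul_zpow_mul_of_involutive ha hb]
    nth_rw 2 [← h]
    rw [← Equiv.Perm.mul_apply, ← mul_assoc, ← zpow_add]
    congr 3
    ring
  · refine hb' (((a * b) ^ (-m - 1)) x) ?_
    rw [← Equiv.Perm.mul_apply, mul_zpow_mul_of_involutive' ha hb]
    nth_rw 2 [← h]
    rw [← Equiv.Perm.mul_apply, ← mul_assoc, ← zpow_add]
    congr 3
    ring

end Dihedral

/-- The simultaneous action of two families of maps on pairs. -/
def mixMap {X Y : Type*} (f : Fin 3 → X → X) (g : Fin 3 → Y → Y) (i : Fin 3) (p : X × Y) : X × Y :=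
  (f i p.1, g i p.2)

section Mix

variable {X Y P Q : Type*} {f : Fin 3 → X → X} {g : Fin 3 → Y → Y} {c : X → Fin 5 → P}
  {d : Y → Fin 5 → Q}

theorem ColorReach.exists_zpow (hf : ∀ i, Function.Involutive (f i))
    (hg : ∀ i, Function.Involutive (g i)) {p q : X × Y}
    (h : ColorReach (mixMap f g) (offRank 3) p q) :
    ∃ k : ℤ,
      (q.1 = (((hf 0).toPerm * (hf 1).toPerm) ^ k) p.1 ∧
        q.2 = (((hg 0).toPerm * (hg 1).toPerm) ^ k) p.2) ∨
      (q.1 = (((hf 0).toPerm * (hf 1).toPerm) ^ k * (hf 0).toPerm) p.1 ∧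
        q.2 = (((hg 0).toPerm * (hg 1).toPerm) ^ k * (hg 0).toPerm) p.2) := by
  have sqf (i) : (hf i).toPerm * (hf i).toPerm = 1 := Equiv.ext (hf i)
  have sqg (i) : (hg i).toPerm * (hg i).toPerm = 1 := Equiv.ext (hg i)
  induction h with
  | refl => exact ⟨0, .inl ⟨rfl, rfl⟩⟩
  | @tail w _ _ h ih =>
    obtain ⟨j, hj, rfl⟩ := h
    have hj : j = 0 ∨ j = 1 := by revert j; simp [offRank]; decide
    have e1 (i : Fin 3) : (mixMap f g i w).1 = ((hf i).toPerm : Equiv.Perm X) w.1 := rfl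
    have e2 (i : Fin 3) : (mixMap f g i w).2 = ((hg i).toPerm : Equiv.Perm Y) w.2 := rfl
    obtain ⟨k, ⟨h1, h2⟩ | ⟨h1, h2⟩⟩ := ih <;> rcases hj with rfl | rfl <;>
      rw [e1, e2, h1, h2] <;> simp only [← Equiv.Perm.mul_apply, ← mul_assoc]
    · exact ⟨-k, .inr (by simp only [mul_zpow_mul_of_involutive, sqf, sqg, and_self])⟩
    · exact ⟨-(k + 1), .inr (by simp only [mul_zpow_mul_of_involutive', sqf, sqg, and_self])⟩
    · refine ⟨-k, .inl ?_⟩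
      simp only [mul_zpow_mul_of_involutive, sqf, sqg, mul_assoc, mul_one, and_self]
    · refine ⟨-(k + 1), .inl ?_⟩
      simp only [mul_zpow_mul_of_involutive', sqf, sqg, mul_assoc, mul_one, and_self]

theorem ColorReach.coord_eq (hf : IsFlagCoordinates f c) {r : Fin 5} {p q : X × Y}
    (h : ColorReach (mixMap f g) (offRank r) p q) : c q.1 r = c p.1 r :=
  h.apply_eq (c := fun p => c p.1 r) fun _ hj _ => hf.adj_of_ne hj _

theorem ColorReach.coord_eq' (hg : IsFlagCoordinates g d) {r : Fin 5} {p q : X × Y}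
    (h : ColorReach (mixMap f g) (offRank r) p q) : d q.2 r = d p.2 r :=
  h.apply_eq (c := fun p => d p.2 r) fun _ hj _ => hg.adj_of_ne hj _

theorem IsFlagCoordinates.eq_or_eq_one (hf : IsFlagCoordinates f c) {x y : X}
    (h1 : c y 1 = c x 1) (h3 : c y 3 = c x 3) : y = x ∨ y = f 1 x := by
  refine hf.eq_or_eq 1 fun r hr => ?_
  have hr : r = 0 ∨ r = 1 ∨ r = 3 ∨ r = 4 := by revert r; decide
  rcases hr with rfl | rfl | rfl | rfl
  · exact hf.zero _ _
  · exact h1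
  · exact h3
  · exact hf.four _ _

/-- A rotation about a face cannot act as a reflection on a flag. -/
theorem IsFlagCoordinates.zpow_apply_ne (hf : IsFlagCoordinates f c) (k : ℤ) (x : X) :
    (((hf.invol 0).toPerm * (hf.invol 1).toPerm) ^ k) x ≠ f 1 x ∧
      (((hf.invol 0).toPerm * (hf.invol 1).toPerm) ^ k * (hf.invol 0).toPerm) x ≠ x := by
  have sq (i) : (hf.invol i).toPerm * (hf.invol i).toPerm = 1 := Equiv.ext (hf.invol i)
  have key := Equiv.Perm.zpow_mul_apply_ne (sq 0) (sq 1) (hf.ne_self 0) (hf.ne_self 1)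
  refine ⟨fun h => key (-(k + 1)) x ?_, key k x⟩
  rw [← mul_zpow_mul_of_involutive' (sq 0) (sq 1), Equiv.Perm.mul_apply, h]
  exact hf.invol 1 x

theorem eq_or_eq_mixMap_one (hf : IsFlagCoordinates f c) (hg : IsFlagCoordinates g d)
    {p q : X × Y} (h1 : ColorReach (mixMap f g) (offRank 1) p q)
    (h3 : ColorReach (mixMap f g) (offRank 3) p q) : q = p ∨ q = mixMap f g 1 p := by
  have hX := hf.eq_or_eq_one (h1.coord_eq hf) (h3.coord_eq hf)
  have hY := hg.eq_or_eq_one (h1.coord_eq' hg) (h3.coord_eq' hg)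
  obtain ⟨k, ⟨hk, hk'⟩ | ⟨hk, hk'⟩⟩ := h3.exists_zpow hf.invol hg.invol
  · refine .inl (Prod.ext (hX.resolve_right fun h => ?_) (hY.resolve_right fun h => ?_))
    · exact (hf.zpow_apply_ne k p.1).1 (hk.symm.trans h)
    · exact (hg.zpow_apply_ne k p.2).1 (hk'.symm.trans h)
  · refine .inr (Prod.ext (hX.resolve_left fun h => ?_) (hY.resolve_left fun h => ?_))
    · exact (hf.zpow_apply_ne k p.1).2 (hk.symm.trans h)
    · exact (hg.zpow_apply_ne k p.2).2 (hk'.symm.trans h)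

/-- A connected system of pairs closed under the mix of two systems of flags is a polyhedral
maniplex. -/
def PolyhedralManiplex.ofMix {Z : Type*} (hf : IsFlagCoordinates f c) (hg : IsFlagCoordinates g d)
    (s : Fin 3 → Z → Z) (e : Z → X × Y) (he : Function.Injective e)
    (hs : ∀ i z, e (s i z) = mixMap f g i (e z)) (z₀ : Z)
    (hz : ∀ z, ColorReach s Set.univ z₀ z) : PolyhedralManiplex Z :=
  have invol (i : Fin 3) (z : Z) : s i (s i z) = z := he <| by
    rw [hs, hs]
    exact Prod.ext (hf.invol i _) (hg.invol i _)
  { s := s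
    invol := invol
    comm := fun z => he <| by
      simp only [hs]
      exact Prod.ext (hf.comm _) (hg.comm _)
    conn := fun z w => ((hz z).symm invol).trans (hz w)
    not_reach := fun i z h => by
      have := (h.map hs).coord_eq hf
      rw [hs] at this
      exact hf.adj_ne i _ this
    inter := fun z w h1 h3 => by
      rcases eq_or_eq_mixMap_one hf hg (h1.map hs) (h3.map hs) with h | h
      · exact .inl (he h)
      · exact .inr (he (h.trans (hs _ _).symm)) }

end Mix

theorem countable_mixOrbit {P Q : Type*} [PartialOrder P] [PartialOrder Q]
    (fP : Fin 3 → Flag P → Flag P) (fQ : Fin 3 → Flag Q → Flag Q) (Φ₀ : Flag P) (Ψ₀ : Flag Q) :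
    (MixOrbit fP fQ Φ₀ Ψ₀).Countable := by
  refine (Set.countable_range fun w : List (Fin 3) =>
    w.foldl (fun p i => mixMap fP fQ i p) (Φ₀, Ψ₀)).mono fun x hx => ?_
  induction hx with
  | refl => exact ⟨[], rfl⟩
  | tail _ h ih =>
    obtain ⟨i, rfl⟩ := h
    obtain ⟨w, rfl⟩ := ih
    exact ⟨w ++ [i], List.foldl_append⟩

/-- The mix of two rooted rank-3 polytopes is polytopal:  if `fP i Φ` (resp. `fQ i Ψ`)
denotes the unique `i`-adjacent flag of `Φ` in `P` (resp. of `Ψ` in `Q`) for `i ∈ {0,1,2}`,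
and `M` is the orbit of `(Φ₀, Ψ₀)` under the group generated by the involutions
`σ_i (Φ, Ψ) = (Φ^i, Ψ^i)`, then there are an abstract polytope `R` of rank `3` and a
bijection `f` from `M` onto the set of flags of `R` with `f (σ_i x)` the `i`-adjacent flag
of `f x` for every `x ∈ M` and every `i`. -/
theorem mix_of_rooted_polyhedra_polytopal {P Q : Type*} [PartialOrder P] [PartialOrder Q]
    (rkP : P → ℤ) (rkQ : Q → ℤ)
    (hP : IsAbstractPolytope 3 P rkP) (hQ : IsAbstractPolytope 3 Q rkQ)
    (Φ₀ : Flag P) (Ψ₀ : Flag Q)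
    (fP : Fin 3 → Flag P → Flag P)
    (hfP : ∀ (i : Fin 3) (Φ : Flag P), IAdjacent rkP (i : ℤ) Φ (fP i Φ))
    (fQ : Fin 3 → Flag Q → Flag Q)
    (hfQ : ∀ (i : Fin 3) (Ψ : Flag Q), IAdjacent rkQ (i : ℤ) Ψ (fQ i Ψ)) :
    ∃ (R : Type) (_ : PartialOrder R) (rkR : R → ℤ),
      IsAbstractPolytope 3 R rkR ∧
      ∃ f : Flag P × Flag Q → Flag R,
        Set.BijOn f (MixOrbit fP fQ Φ₀ Ψ₀) Set.univ ∧
        ∀ x ∈ MixOrbit fP fQ Φ₀ Ψ₀, ∀ i : Fin 3,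
          IAdjacent rkR (i : ℤ) (f x) (f (fP i x.1, fQ i x.2)) := by
  obtain ⟨c, hc⟩ := hP.exists_isFlagCoordinates hfP
  obtain ⟨d, hd⟩ := hQ.exists_isFlagCoordinates hfQ
  have : Countable (MixOrbit fP fQ Φ₀ Ψ₀) := (countable_mixOrbit fP fQ Φ₀ Ψ₀).to_subtype
  let E := equivShrink.{0} (MixOrbit fP fQ Φ₀ Ψ₀)
  let e (z : Shrink.{0} (MixOrbit fP fQ Φ₀ Ψ₀)) : Flag P × Flag Q := (E.symm z).1
  have hstep (i : Fin 3) {p : Flag P × Flag Q} (hp : p ∈ MixOrbit fP fQ Φ₀ Ψ₀) :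
      mixMap fP fQ i p ∈ MixOrbit fP fQ Φ₀ Ψ₀ := Relation.ReflTransGen.tail hp ⟨i, rfl⟩
  let s (i : Fin 3) (z : Shrink.{0} (MixOrbit fP fQ Φ₀ Ψ₀)) : Shrink.{0} (MixOrbit fP fQ Φ₀ Ψ₀) :=
    E ⟨mixMap fP fQ i (e z), hstep i (E.symm z).2⟩
  have he : Function.Injective e := Subtype.val_injective.comp E.symm.injective
  have hs (i z) : e (s i z) = mixMap fP fQ i (e z) := by simp [e, s]
  let z₀ := E ⟨(Φ₀, Ψ₀), Relation.ReflTransGen.refl⟩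
  have hconn : ∀ p (hp : p ∈ MixOrbit fP fQ Φ₀ Ψ₀), ColorReach s Set.univ z₀ (E ⟨p, hp⟩) := by
    intro p hp
    induction hp with
    | refl => exact .refl _
    | tail h h' ih =>
      obtain ⟨i, rfl⟩ := h'
      have : s i (E ⟨_, h⟩) = E ⟨mixMap fP fQ i _, hstep i h⟩ := he (by rw [hs]; simp [e])
      exact ih.trans (this ▸ .single (Set.mem_univ i) _)
  let M := PolyhedralManiplex.ofMix hc hd s e he hs z₀ fun z => by
    simpa using hconn _ (E.symm z).2
  have : Nonempty (Shrink.{0} (MixOrbit fP fQ Φ₀ Ψ₀)) := ⟨z₀⟩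
  classical
  let φ (p : Flag P × Flag Q) : Flag M.Face :=
    if hp : p ∈ MixOrbit fP fQ Φ₀ Ψ₀ then M.flagOf (E ⟨p, hp⟩) else M.flagOf z₀
  have hφ {p} (hp : p ∈ MixOrbit fP fQ Φ₀ Ψ₀) : φ p = M.flagOf (E ⟨p, hp⟩) := dif_pos hp
  refine ⟨M.Face, inferInstance, M.rk, M.isAbstractPolytope, φ, ⟨fun _ _ => trivial, ?_, ?_⟩, ?_⟩
  · intro p hp q hq h
    rw [hφ hp, hφ hq] at h
    exact congrArg Subtype.val (E.injective (M.flagOf_injective h))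
  · intro Φ _
    obtain ⟨z, rfl⟩ := M.flagOf_surjective Φ
    exact ⟨e z, (E.symm z).2, by rw [hφ (E.symm z).2]; simp⟩
  · intro p hp i
    have : M.s i (E ⟨p, hp⟩) = E ⟨mixMap fP fQ i p, hstep i hp⟩ :=
      he ((hs _ _).trans (by simp [e]))
    change IAdjacent M.rk (i : ℤ) (φ p) (φ (mixMap fP fQ i p))
    rw [hφ hp, hφ (hstep i hp), ← this]
    exact M.adjacent_flagOf i _
end

section
/- For every odd integer k ≥ 5, there exists a finite abstract polytope P of rank 3 such that the automorphism group of P has exactly k orbits on the set of flags of P, and no rank-2 section of P is a digon; that is, for all faces F < G with rk G − rk F = 3, there are at least three faces H of rank rk F + 1 with F < H < G. -/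
/-- Two flags are in the same orbit when some automorphism (order isomorphism) of `P` maps
one onto the other. -/
def flagOrbitRel (P : Type*) [PartialOrder P] (Φ Ψ : Flag P) : Prop :=
  ∃ σ : P ≃o P, ∀ F : P, F ∈ Ψ ↔ σ.symm F ∈ Φ

/-- The rank function on a poset with a new least face and a new greatest face adjoined, the
proper faces having their ranks given by `r`. -/
def extRank {C : Type*} (r : C → ℤ) : WithBot (WithTop C) → ℤ
  | none => -1
  | some none => 3
  | some (some c) => r c

/-- Two elements of `S` are comparable. -/
def ComparableIn {C : Type*} [PartialOrder C] (S : Set C) (a b : C) : Prop :=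
  a ∈ S ∧ b ∈ S ∧ (a ≤ b ∨ b ≤ a)

lemma ComparableIn.reflTransGen_symm {C : Type*} [PartialOrder C] {S : Set C} {a b : C}
    (h : Relation.ReflTransGen (ComparableIn S) a b) :
    Relation.ReflTransGen (ComparableIn S) b a :=
  have : Std.Symm (ComparableIn S) := ⟨fun _ _ hab => ⟨hab.2.1, hab.1, hab.2.2.symm⟩⟩
  Relation.ReflTransGen.stdSymm.symm _ _ h

/-- A flag of a polyhedron, without its least and greatest face. -/
@[ext] structure ProperFlag (C : Type*) [PartialOrder C] where
  /-- The vertex of the flag. -/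
  vertex : C
  /-- The edge of the flag. -/
  edge : C
  /-- The two-dimensional face of the flag. -/
  face : C
  vertex_lt : vertex < edge
  edge_lt : edge < face

/-- The image of a flag under an automorphism. -/
@[simps] def ProperFlag.map {C : Type*} [PartialOrder C] (A : ProperFlag C) (τ : C ≃o C) :
    ProperFlag C where
  vertex := τ A.vertex
  edge := τ A.edge
  face := τ A.face
  vertex_lt := τ.lt_iff_lt.2 A.vertex_lt
  edge_lt := τ.lt_iff_lt.2 A.edge_lt

/-- The conditions on the poset of proper faces which make it a polyhedron once a least and a
greatest face are adjoined. -/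
structure IsPolyhedral {C : Type*} [PartialOrder C] (r : C → ℤ) : Prop where
  nonempty : Nonempty C
  strictMono : StrictMono r
  nonneg : ∀ c, 0 ≤ r c
  le_two : ∀ c, r c ≤ 2
  exists_lt : ∀ c, 0 < r c → ∃ d, d < c
  exists_gt : ∀ c, r c < 2 → ∃ d, c < d
  edge_vertices : ∀ e, r e = 1 → ∃ v w, v ≠ w ∧ ∀ c, c < e ↔ c = v ∨ c = w
  edge_faces : ∀ e, r e = 1 → ∃ f g, f ≠ g ∧ ∀ c, e < c ↔ c = f ∨ c = g
  corner_edges : ∀ v f, v < f → r v = 0 → r f = 2 →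
    ∃ d e, d ≠ e ∧ ∀ c, v < c ∧ c < f ↔ c = d ∨ c = e
  connected : ∀ c d : C, Relation.ReflTransGen (ComparableIn Set.univ) c d
  connected_below : ∀ f, r f = 2 → ∀ c d, c < f → d < f →
    Relation.ReflTransGen (ComparableIn (Set.Iio f)) c d
  connected_above : ∀ v, r v = 0 → ∀ c d, v < c → v < d →
    Relation.ReflTransGen (ComparableIn (Set.Ioi v)) c d

namespace IsPolyhedral

section
variable {C : Type*}

@[simp] lemma extRank_bot (r : C → ℤ) : extRank r ⊥ = -1 := rfl
@[simp] lemma extRank_top (r : C → ℤ) : extRank r ⊤ = 3 := rfl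
@[simp] lemma extRank_coe (r : C → ℤ) (c : C) :
    extRank r ((c : WithTop C) : WithBot (WithTop C)) = r c := rfl

lemma face_cases (F : WithBot (WithTop C)) :
    F = ⊥ ∨ F = ⊤ ∨ ∃ c : C, F = ((c : WithTop C) : WithBot (WithTop C)) := by
  induction F using WithBot.recBotCoe with
  | bot => exact Or.inl rfl
  | coe F =>
    induction F using WithTop.recTopCoe with
    | top => exact Or.inr (Or.inl rfl)
    | coe c => exact Or.inr (Or.inr ⟨c, rfl⟩)

@[simp] lemma coe_lt_top [PartialOrder C] (c : C) :
    ((c : WithTop C) : WithBot (WithTop C)) < ⊤ :=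
  WithBot.coe_lt_coe.2 (WithTop.coe_lt_top c)

@[simp] lemma coe_ne_top (c : C) : ((c : WithTop C) : WithBot (WithTop C)) ≠ ⊤ :=
  fun h => WithTop.coe_ne_top (WithBot.coe_injective h)

end

variable {C : Type*} [PartialOrder C] {r : C → ℤ}

lemma extRank_strictMono (h : IsPolyhedral r) : StrictMono (extRank r) := by
  intro F G hFG
  rcases face_cases F with rfl | rfl | ⟨c, rfl⟩ <;> rcases face_cases G with rfl | rfl | ⟨d, rfl⟩
  · simp at hFG
  · simp
  · have := h.nonneg d
    simp only [extRank_bot, extRank_coe]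
    omega
  · simp at hFG
  · simp at hFG
  · simp at hFG
  · simp at hFG
  · have := h.le_two c
    simp only [extRank_top, extRank_coe]
    omega
  · exact h.strictMono (by simpa using hFG)

lemma exists_between (h : IsPolyhedral r) {F G : WithBot (WithTop C)} (hFG : F < G)
    (hr : extRank r F + 2 ≤ extRank r G) : ∃ H, F < H ∧ H < G := by
  rcases face_cases F with rfl | rfl | ⟨c, rfl⟩ <;> rcases face_cases G with rfl | rfl | ⟨d, rfl⟩
  · simp at hFG
  · obtain ⟨c⟩ := h.nonempty
    exact ⟨((c : WithTop C) : WithBot (WithTop C)), by simp⟩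
  · simp only [extRank_bot, extRank_coe] at hr
    obtain ⟨e, he⟩ := h.exists_lt d (by omega)
    exact ⟨((e : WithTop C) : WithBot (WithTop C)), by simp [he]⟩
  · simp at hFG
  · simp at hFG
  · simp at hFG
  · simp at hFG
  · simp only [extRank_top, extRank_coe] at hr
    obtain ⟨e, he⟩ := h.exists_gt c (by omega)
    exact ⟨((e : WithTop C) : WithBot (WithTop C)), by simp [he]⟩
  · simp only [extRank_coe] at hr
    have := h.nonneg c
    have := h.le_two d
    obtain ⟨a, b, -, hab⟩ := h.corner_edges c d (by simpa using hFG) (by omega) (by omega)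
    have := (hab a).2 (Or.inl rfl)
    exact ⟨((a : WithTop C) : WithBot (WithTop C)), by simpa using this⟩

lemma flag_ranks (h : IsPolyhedral r) (Φ : Flag (WithBot (WithTop C))) (j : ℤ)
    (hj : -1 ≤ j) (hj' : j ≤ 3) : ∃! F, F ∈ Φ ∧ extRank r F = j := by
  have mono := h.extRank_strictMono
  have total : ∀ {F G}, F ∈ Φ → G ∈ Φ → extRank r F ≤ extRank r G → F ≤ G := by
    intro F G hF hG hr
    rcases Φ.le_or_le hF hG with hle | hle
    · exact hle
    · rcases hle.eq_or_lt with rfl | hlt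
      · exact le_rfl
      · exact absurd (mono hlt) (by omega)
  have bounds : ∀ F : WithBot (WithTop C), -1 ≤ extRank r F ∧ extRank r F ≤ 3 := fun F =>
    ⟨mono.monotone (bot_le (a := F)), mono.monotone (le_top (a := F))⟩
  have unique : ∀ F G, F ∈ Φ ∧ extRank r F = j → G ∈ Φ ∧ extRank r G = j → F = G :=
    fun F G hF hG => le_antisymm (total hF.1 hG.1 (by omega)) (total hG.1 hF.1 (by omega))
  suffices ∃ F, F ∈ Φ ∧ extRank r F = j by
    obtain ⟨F, hF⟩ := this
    exact ⟨F, hF, fun G hG => unique G F hG hF⟩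
  by_contra hno
  push Not at hno
  obtain ⟨a, ⟨F, hF, rfl, hFj⟩, hFmax⟩ := Int.exists_greatest_of_bdd
    (P := fun z => ∃ F ∈ Φ, extRank r F = z ∧ z ≤ j) ⟨j, by rintro z ⟨_, _, _, hz⟩; exact hz⟩
    ⟨-1, ⊥, Φ.bot_mem, rfl, hj⟩
  obtain ⟨b, ⟨G, hG, rfl, hGj⟩, hGmin⟩ := Int.exists_least_of_bdd
    (P := fun z => ∃ G ∈ Φ, extRank r G = z ∧ j ≤ z) ⟨j, by rintro z ⟨_, _, _, hz⟩; exact hz⟩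
    ⟨3, ⊤, Φ.top_mem, rfl, hj'⟩
  have hFne := hno F hF
  have hGne := hno G hG
  have hFG : F < G := lt_of_le_of_ne (total hF hG (by omega)) (by rintro rfl; omega)
  obtain ⟨H, hFH, hHG⟩ := h.exists_between hFG (by omega)
  have hH : H ∈ Φ := by
    refine Flag.mem_iff_forall_le_or_ge.2 fun K hK => ?_
    rcases le_total (extRank r K) j with hKj | hKj
    · exact Or.inr ((total hK hF (hFmax _ ⟨K, hK, rfl, hKj⟩)).trans hFH.le)
    · exact Or.inl (hHG.le.trans (total hG hK (hGmin _ ⟨K, hK, rfl, hKj⟩)))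
  have h1 := mono hFH
  have h2 := mono hHG
  rcases le_total (extRank r H) j with hHj | hHj
  · exact absurd (hFmax _ ⟨H, hH, rfl, hHj⟩) (by omega)
  · exact absurd (hGmin _ ⟨H, hH, rfl, hHj⟩) (by omega)

lemma diamond (h : IsPolyhedral r) (F G : WithBot (WithTop C)) (hFG : F < G)
    (hr : extRank r G = extRank r F + 2) :
    ∃ H₁ H₂, H₁ ≠ H₂ ∧ {H | F < H ∧ H < G} = {H₁, H₂} := by
  have lift : ∀ a b : C, a ≠ b →
      (∀ c : C, F < ((c : WithTop C) : WithBot (WithTop C)) ∧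
        ((c : WithTop C) : WithBot (WithTop C)) < G ↔ c = a ∨ c = b) →
      ∃ H₁ H₂, H₁ ≠ H₂ ∧ {H | F < H ∧ H < G} = {H₁, H₂} := by
    intro a b hab hc
    refine ⟨((a : WithTop C) : WithBot (WithTop C)), ((b : WithTop C) : WithBot (WithTop C)),
      by simpa using hab, ?_⟩
    ext H
    rcases face_cases H with rfl | rfl | ⟨c, rfl⟩
    · simp
    · simp
    · simpa using hc c
  rcases face_cases F with rfl | rfl | ⟨c, rfl⟩ <;> rcases face_cases G with rfl | rfl | ⟨d, rfl⟩
  · simp at hFG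
  · simp at hr
  · simp only [extRank_bot, extRank_coe] at hr
    obtain ⟨a, b, hab, hc⟩ := h.edge_vertices d (by omega)
    exact lift a b hab (by simpa using hc)
  · simp at hFG
  · simp at hFG
  · simp at hFG
  · simp at hFG
  · simp only [extRank_top, extRank_coe] at hr
    obtain ⟨a, b, hab, hc⟩ := h.edge_faces c (by omega)
    exact lift a b hab (by simpa using hc)
  · simp only [extRank_coe] at hr
    have := h.nonneg c
    have := h.le_two d
    obtain ⟨a, b, hab, hc⟩ := h.corner_edges c d (by simpa using hFG) (by omega) (by omega)
    exact lift a b hab (by simpa using hc)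

lemma sections_connected (h : IsPolyhedral r) (F G H H' : WithBot (WithTop C)) (hFG : F < G)
    (hr : extRank r F + 3 ≤ extRank r G) (h₁ : F < H) (h₂ : H < G) (h₃ : F < H') (h₄ : H' < G) :
    Relation.ReflTransGen
      (fun A B => F < A ∧ A < G ∧ F < B ∧ B < G ∧ (A ≤ B ∨ B ≤ A)) H H' := by
  have proper : ∀ K, F < K → K < G → ∃ c : C, K = ((c : WithTop C) : WithBot (WithTop C)) := by
    intro K hFK hKG
    rcases face_cases K with rfl | rfl | hK
    · exact absurd hFK not_lt_bot
    · exact absurd hKG (not_lt_of_ge le_top)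
    · exact hK
  obtain ⟨c, rfl⟩ := proper H h₁ h₂
  obtain ⟨d, rfl⟩ := proper H' h₃ h₄
  have lift : ∀ S : Set C, (∀ a ∈ S, F < ((a : WithTop C) : WithBot (WithTop C)) ∧
      ((a : WithTop C) : WithBot (WithTop C)) < G) →
      Relation.ReflTransGen (ComparableIn S) c d →
      Relation.ReflTransGen (fun A B => F < A ∧ A < G ∧ F < B ∧ B < G ∧ (A ≤ B ∨ B ≤ A))
        ((c : WithTop C) : WithBot (WithTop C)) ((d : WithTop C) : WithBot (WithTop C)) := by
    intro S hS hcd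
    refine hcd.lift (fun a : C => ((a : WithTop C) : WithBot (WithTop C))) ?_
    rintro a b ⟨ha, hb, hab⟩
    exact ⟨(hS a ha).1, (hS a ha).2, (hS b hb).1, (hS b hb).2, by simpa using hab⟩
  rcases face_cases F with rfl | rfl | ⟨v, rfl⟩ <;> rcases face_cases G with rfl | rfl | ⟨f, rfl⟩
  · simp at hFG
  · exact lift _ (by simp) (h.connected c d)
  · simp only [extRank_bot, extRank_coe] at hr
    have := h.le_two f
    exact lift _ (by simp) (h.connected_below f (by omega) c d (by simpa using h₂)
      (by simpa using h₄))
  · simp at hFG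
  · simp at hFG
  · simp at hFG
  · simp at hFG
  · simp only [extRank_top, extRank_coe] at hr
    have := h.nonneg v
    exact lift _ (by simp) (h.connected_above v (by omega) c d (by simpa using h₁)
      (by simpa using h₃))
  · simp only [extRank_coe] at hr
    have := h.nonneg v
    have := h.le_two f
    omega

/-- Adjoining a least and a greatest face to the proper faces gives an abstract polytope. -/
theorem isAbstractPolytope (h : IsPolyhedral r) :
    IsAbstractPolytope 3 (WithBot (WithTop C)) (extRank r) where
  strictMono := h.extRank_strictMono
  exists_bot := ⟨⊥, rfl, fun _ => bot_le⟩
  exists_top := ⟨_, rfl, fun F => le_top (a := F)⟩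
  flag_ranks := h.flag_ranks
  diamond := h.diamond
  connected := h.sections_connected

lemma rank_properFlag (h : IsPolyhedral r) (A : ProperFlag C) :
    r A.vertex = 0 ∧ r A.edge = 1 ∧ r A.face = 2 := by
  have := h.nonneg A.vertex
  have := h.le_two A.face
  have := h.strictMono A.vertex_lt
  have := h.strictMono A.edge_lt
  omega

/-- The faces of the flag `A`, as a set of faces of the polyhedron. -/
def faces (A : ProperFlag C) : Set (WithBot (WithTop C)) :=
  {⊥, ⊤, ((A.vertex : WithTop C) : WithBot (WithTop C)),
    ((A.edge : WithTop C) : WithBot (WithTop C)), ((A.face : WithTop C) : WithBot (WithTop C))}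

lemma exists_properFlag (h : IsPolyhedral r) (Φ : Flag (WithBot (WithTop C))) :
    ∃ A : ProperFlag C, ∀ F, F ∈ Φ ↔ F ∈ faces A := by
  have mono := h.extRank_strictMono
  have cell : ∀ j : ℤ, 0 ≤ j → j ≤ 2 →
      ∃ c : C, ((c : WithTop C) : WithBot (WithTop C)) ∈ Φ ∧ r c = j := by
    intro j hj₀ hj₂
    obtain ⟨F, ⟨hF, hFj⟩, -⟩ := h.flag_ranks Φ j (by omega) (by omega)
    rcases face_cases F with rfl | rfl | ⟨c, rfl⟩
    · simp at hFj
      omega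
    · simp at hFj
      omega
    · exact ⟨c, hF, hFj⟩
  have lt : ∀ c d : C, ((c : WithTop C) : WithBot (WithTop C)) ∈ Φ →
      ((d : WithTop C) : WithBot (WithTop C)) ∈ Φ → r c < r d → c < d := by
    intro c d hc hd hcd
    rcases Φ.le_or_le hc hd with hle | hle
    · have hle : c ≤ d := by simpa using hle
      exact hle.lt_of_ne (by rintro rfl; omega)
    · have hle : d ≤ c := by simpa using hle
      exact absurd (h.strictMono.monotone hle) (by omega)
  obtain ⟨v, hv, hv'⟩ := cell 0 (by norm_num) (by norm_num)
  obtain ⟨e, he, he'⟩ := cell 1 (by norm_num) (by norm_num)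
  obtain ⟨f, hf, hf'⟩ := cell 2 (by norm_num) (by norm_num)
  refine ⟨⟨v, e, f, lt v e hv he (by omega), lt e f he hf (by omega)⟩, fun F => ⟨fun hF => ?_, ?_⟩⟩
  · have eq : ∀ c d : C, ((c : WithTop C) : WithBot (WithTop C)) ∈ Φ →
        ((d : WithTop C) : WithBot (WithTop C)) ∈ Φ → r c = r d → c = d := by
      intro c d hc hd hcd
      have := h.nonneg c
      have := h.le_two c
      have := (h.flag_ranks Φ (r c) (by omega) (by omega)).unique ⟨hc, rfl⟩ ⟨hd, hcd.symm⟩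
      simpa using this
    rcases face_cases F with rfl | rfl | ⟨c, rfl⟩
    · simp [faces]
    · simp [faces]
    · have := h.nonneg c
      have := h.le_two c
      rcases (by omega : r c = 0 ∨ r c = 1 ∨ r c = 2) with hc | hc | hc
      · simp [faces, eq c v hF hv (by omega)]
      · simp [faces, eq c e hF he (by omega)]
      · simp [faces, eq c f hF hf (by omega)]
  · rintro (rfl | rfl | rfl | rfl | rfl)
    · exact Φ.bot_mem
    · exact Φ.top_mem
    · exact hv
    · exact he
    · exact hf

lemma eq_of_faces_subset (h : IsPolyhedral r) {A B : ProperFlag C} (hAB : faces A ⊆ faces B) :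
    A = B := by
  obtain ⟨hA₁, hA₂, hA₃⟩ := h.rank_properFlag A
  obtain ⟨hB₁, hB₂, hB₃⟩ := h.rank_properFlag B
  have key : ∀ c : C, ((c : WithTop C) : WithBot (WithTop C)) ∈ faces A →
      c = B.vertex ∨ c = B.edge ∨ c = B.face := by
    intro c hc
    simpa [faces] using hAB hc
  have h₁ := key A.vertex (by simp [faces])
  have h₂ := key A.edge (by simp [faces])
  have h₃ := key A.face (by simp [faces])
  refine ProperFlag.ext ?_ ?_ ?_
  · rcases h₁ with h | h | h
    · exact h
    all_goals rw [h] at hA₁; omega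
  · rcases h₂ with h | h | h
    · rw [h] at hA₂; omega
    · exact h
    · rw [h] at hA₂; omega
  · rcases h₃ with h | h | h
    · rw [h] at hA₃; omega
    · rw [h] at hA₃; omega
    · exact h

lemma exists_flag (h : IsPolyhedral r) (A : ProperFlag C) :
    ∃ Φ : Flag (WithBot (WithTop C)), ∀ F, F ∈ Φ ↔ F ∈ faces A := by
  have hchain : IsChain (· ≤ ·) (faces A) := by
    have h₁ := A.vertex_lt.le
    have h₂ := A.edge_lt.le
    have h₃ := h₁.trans h₂
    rintro F (rfl | rfl | rfl | rfl | rfl) G (rfl | rfl | rfl | rfl | rfl) - <;>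
      simp [h₁, h₂, h₃]
  obtain ⟨Φ, hΦ⟩ := hchain.exists_subset_flag
  obtain ⟨B, hB⟩ := h.exists_properFlag Φ
  have hAB : A = B := h.eq_of_faces_subset fun F hF => (hB F).1 (hΦ hF)
  exact ⟨Φ, hAB ▸ hB⟩

/-- The extension of an automorphism of the poset of proper faces. -/
def extIso (τ : C ≃o C) : WithBot (WithTop C) ≃o WithBot (WithTop C) :=
  τ.withTopCongr.withBotCongr

lemma mem_faces_map (τ : C ≃o C) (A : ProperFlag C) (F : WithBot (WithTop C)) :
    F ∈ faces (A.map τ) ↔ (extIso τ).symm F ∈ faces A := by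
  have hcoe : ∀ c : C, extIso τ ((c : WithTop C) : WithBot (WithTop C)) =
    ((τ c : WithTop C) : WithBot (WithTop C)) := fun _ => rfl
  simp only [faces, ProperFlag.map, Set.mem_insert_iff, Set.mem_singleton_iff,
    OrderIso.symm_apply_eq, hcoe, map_bot, map_top]

lemma exists_restrict (σ : WithBot (WithTop C) ≃o WithBot (WithTop C)) :
    ∃ τ : C ≃o C, σ = extIso τ := by
  have key : ∀ (σ : WithBot (WithTop C) ≃o WithBot (WithTop C)) (c : C), ∃ d : C,
      σ ((c : WithTop C) : WithBot (WithTop C)) = ((d : WithTop C) : WithBot (WithTop C)) := by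
    intro σ c
    rcases face_cases (σ ((c : WithTop C) : WithBot (WithTop C))) with h | h | h
    · simp at h
    · simp at h
    · exact h
  choose g hg using key σ
  choose g' hg' using key σ.symm
  have inj : ∀ c d : C, ((c : WithTop C) : WithBot (WithTop C)) =
      ((d : WithTop C) : WithBot (WithTop C)) → c = d := fun c d h => by simpa using h
  refine ⟨⟨⟨g, g', fun c => inj _ _ ?_, fun c => inj _ _ ?_⟩, ?_⟩, ?_⟩
  · rw [← hg', ← hg, σ.symm_apply_apply]
  · rw [← hg, ← hg', σ.apply_symm_apply]
  · intro c d
    have : ((g c : WithTop C) : WithBot (WithTop C)) ≤ ((g d : WithTop C) : WithBot (WithTop C)) ↔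
        ((c : WithTop C) : WithBot (WithTop C)) ≤ ((d : WithTop C) : WithBot (WithTop C)) := by
      rw [← hg, ← hg, σ.le_iff_le]
    simpa using this
  · refine RelIso.ext fun F => ?_
    rcases face_cases F with rfl | rfl | ⟨c, rfl⟩
    · simp
    · simp
    · exact hg c

/-- A complete invariant of flags up to automorphism counts the flag orbits. -/
theorem card_flagOrbit (h : IsPolyhedral r) (K : ℕ) (q : ProperFlag C → ℕ)
    (map_eq : ∀ A τ, q (ProperFlag.map A τ) = q A)
    (exists_map : ∀ A B, q A = q B → ∃ τ, ProperFlag.map A τ = B)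
    (lt : ∀ A, q A < K) (surj : ∀ n < K, ∃ A, q A = n) :
    Nat.card (Quot (flagOrbitRel (WithBot (WithTop C)))) = K := by
  choose p hp using h.exists_properFlag
  have hrel : ∀ Φ Ψ, flagOrbitRel (WithBot (WithTop C)) Φ Ψ ↔ ∃ τ, (p Φ).map τ = p Ψ := by
    intro Φ Ψ
    constructor
    · rintro ⟨σ, hσ⟩
      obtain ⟨τ, rfl⟩ := exists_restrict σ
      refine ⟨τ, h.eq_of_faces_subset fun F hF => ?_⟩
      rw [← hp, hσ, hp, ← mem_faces_map]
      exact hF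
    · rintro ⟨τ, hτ⟩
      refine ⟨extIso τ, fun F => ?_⟩
      rw [hp, hp, ← mem_faces_map, hτ]
  let Q : Quot (flagOrbitRel (WithBot (WithTop C))) → Fin K :=
    Quot.lift (fun Φ => ⟨q (p Φ), lt _⟩) fun Φ Ψ hΦΨ => by
      obtain ⟨τ, hτ⟩ := (hrel Φ Ψ).1 hΦΨ
      simp only [← hτ, map_eq]
  have hQ : Function.Bijective Q := by
    constructor
    · rintro ⟨Φ⟩ ⟨Ψ⟩ heq
      exact Quot.sound ((hrel Φ Ψ).2 (exists_map _ _ (Fin.mk.inj_iff.1 heq)))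
    · rintro ⟨n, hn⟩
      obtain ⟨A, hA⟩ := surj n hn
      obtain ⟨Φ, hΦ⟩ := h.exists_flag A
      refine ⟨Quot.mk _ Φ, Fin.ext ?_⟩
      have : p Φ = A := h.eq_of_faces_subset fun F hF => by rwa [← hΦ, hp]
      change q (p Φ) = n
      rw [this, hA]
  rw [Nat.card_congr (Equiv.ofBijective Q hQ), Nat.card_fin]

end IsPolyhedral

/-- The proper faces of a stack of triangular prisms.  The odd levels `1, 3, …, k` carry the
triangular layers, the even levels between them the prisms, and the two extreme levels
`0` and `k + 1` the two triangular caps.  At its level a face spans the vertices in `base`. -/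
@[ext] structure StackCell (k : ℕ) where
  /-- The level of the face. -/
  level : ℕ
  /-- The vertices of the triangle spanned by the face. -/
  base : Finset (Fin 3)
  level_le : level ≤ k + 1
  card_pos : 1 ≤ base.card
  card_eq_three : base.card = 3 ↔ level = 0 ∨ level = k + 1

namespace StackCell

variable {k : ℕ}

lemma card_le (c : StackCell k) : c.base.card ≤ 3 := by simpa using Finset.card_le_univ c.base

instance : PartialOrder (StackCell k) where
  le c d := (c.level = d.level ∨ d.level % 2 = 0 ∧ (c.level + 1 = d.level ∨ d.level + 1 = c.level))
    ∧ c.base ⊆ d.base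
  le_refl c := ⟨Or.inl rfl, subset_rfl⟩
  le_trans c d e h₁ h₂ := ⟨by have := h₁.1; have := h₂.1; omega, h₁.2.trans h₂.2⟩
  le_antisymm c d h₁ h₂ := StackCell.ext (by have := h₁.1; have := h₂.1; omega)
    (h₁.2.antisymm h₂.2)

lemma le_iff {c d : StackCell k} : c ≤ d ↔ (c.level = d.level ∨
    d.level % 2 = 0 ∧ (c.level + 1 = d.level ∨ d.level + 1 = c.level)) ∧ c.base ⊆ d.base := Iff.rfl

lemma lt_iff {c d : StackCell k} : c < d ↔ (c.level = d.level ∧ c.base ⊂ d.base) ∨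
    (d.level % 2 = 0 ∧ (c.level + 1 = d.level ∨ d.level + 1 = c.level) ∧ c.base ⊆ d.base) := by
  rw [lt_iff_le_and_ne, le_iff, ne_eq, StackCell.ext_iff, Finset.ssubset_iff_subset_ne]
  by_cases h : c.level = d.level
  · simp [h]
  · simp only [h, false_or, false_and, not_false_eq_true, and_true]
    tauto

instance : Finite (StackCell k) :=
  Finite.of_injective
    (fun c => ((⟨c.level, Nat.lt_succ_of_le c.level_le⟩, c.base) : Fin (k + 2) × Finset (Fin 3)))
    fun c d h => by
      simp only [Prod.mk.injEq, Fin.mk.injEq] at h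
      exact StackCell.ext h.1 h.2

/-- The rank of a proper face. -/
def rank (c : StackCell k) : ℤ := min 2 (c.base.card - (c.level % 2 : ℕ))

lemma rank_strictMono (hk : Odd k) : StrictMono (rank (k := k)) := by
  intro c d h
  have hk' := Nat.odd_iff.1 hk
  have := c.card_eq_three
  have := d.card_eq_three
  have := d.card_le
  unfold rank
  rcases lt_iff.1 h with ⟨h₁, h₂⟩ | ⟨h₁, h₂, h₃⟩
  · have := Finset.card_lt_card h₂
    omega
  · have := Finset.card_le_card h₃
    have := d.level_le
    omega

lemma eq_univ {s : Finset (Fin 3)} (h : s.card = 3) : s = Finset.univ :=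
  Finset.eq_univ_of_card s h

lemma exists_singletons : ∀ s : Finset (Fin 3), s.card = 2 → ∃ a b, a ≠ b ∧
    s = {a, b} ∧ ∀ t : Finset (Fin 3), 1 ≤ t.card → (t ⊂ s ↔ t = {a} ∨ t = {b}) := by
  decide

lemma exists_pairs : ∀ s : Finset (Fin 3), s.card = 1 → ∃ t u, t ≠ u ∧ t.card = 2 ∧ u.card = 2 ∧
    s ⊂ t ∧ s ⊂ u ∧ ∀ w : Finset (Fin 3), w.card ≤ 2 → (s ⊂ w ↔ w = t ∨ w = u) := by
  decide

lemma exists_cell {x : ℕ} {s : Finset (Fin 3)} (hx : x ≤ k + 1) (h₁ : 1 ≤ s.card)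
    (h₂ : s.card ≤ 2) : ∃ c : StackCell k, c.level = x ∧ s ⊆ c.base ∧
      (1 ≤ x → x ≤ k → c.base = s) := by
  by_cases h : x = 0 ∨ x = k + 1
  · exact ⟨⟨x, Finset.univ, hx, by simp, by simpa using h⟩, rfl, s.subset_univ, by omega⟩
  · exact ⟨⟨x, s, hx, h₁, by omega⟩, rfl, subset_rfl, fun _ _ => rfl⟩

lemma rank_eq_zero {c : StackCell k} : c.rank = 0 ↔ c.level % 2 = 1 ∧ c.base.card = 1 := by
  have := c.card_pos
  unfold rank
  omega

lemma rank_eq_one {c : StackCell k} : c.rank = 1 ↔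
    c.level % 2 = 1 ∧ c.base.card = 2 ∨ c.level % 2 = 0 ∧ c.base.card = 1 := by
  have := c.card_pos
  unfold rank
  omega

lemma rank_eq_two (hk : Odd k) {c : StackCell k} : c.rank = 2 ↔
    c.level % 2 = 0 ∧ (c.base.card = 2 ∨ c.base.card = 3) := by
  have := c.card_le
  have := c.card_eq_three
  have := Nat.odd_iff.1 hk
  unfold rank
  omega

lemma rank_cases (hk : Odd k) (c : StackCell k) : c.rank = 0 ∨ c.rank = 1 ∨ c.rank = 2 := by
  rw [rank_eq_zero, rank_eq_one, rank_eq_two hk]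
  have := c.card_pos
  have := c.card_le
  have := c.card_eq_three
  have := Nat.odd_iff.1 hk
  omega

lemma base_subset_of_lt {c d : StackCell k} (h : c < d) : c.base ⊆ d.base := h.le.2

lemma base_eq_of_subset {c d : StackCell k} (h : c.base ⊆ d.base)
    (hcard : d.base.card ≤ c.base.card) : c.base = d.base := Finset.eq_of_subset_of_card_le h hcard

lemma level_bounds (hk : Odd k) {c : StackCell k} (h : c.base.card ≤ 2) :
    1 ≤ c.level ∧ c.level ≤ k ∧ (c.level % 2 = 0 → 2 ≤ c.level ∧ c.level + 1 ≤ k) := by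
  have := c.level_le
  have := c.card_eq_three
  have := Nat.odd_iff.1 hk
  omega

lemma base_subset_iff_eq {c d : StackCell k} (h : d.base.card = 1) :
    c.base ⊆ d.base ↔ c.base = d.base :=
  ⟨fun hs => base_eq_of_subset hs (by have := c.card_pos; omega), fun hs => hs.subset⟩

lemma not_base_ssubset {c d : StackCell k} (h : d.base.card = 1) : ¬ c.base ⊂ d.base := by
  intro hs
  have := Finset.card_lt_card hs
  have := c.card_pos
  omega

lemma edge_vertices (hk : Odd k) (e : StackCell k) (he : e.rank = 1) :
    ∃ v w, v ≠ w ∧ ∀ c, c < e ↔ c = v ∨ c = w := by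
  rcases rank_eq_one.1 he with ⟨h₁, h₂⟩ | ⟨h₁, h₂⟩
  · obtain ⟨hl₁, hl₂, -⟩ := level_bounds hk h₂.le
    obtain ⟨a, b, hab, -, hs⟩ := exists_singletons e.base h₂
    obtain ⟨v, hv, -, hv'⟩ := exists_cell (s := {a}) e.level_le (by simp) (by simp)
    obtain ⟨w, hw, -, hw'⟩ := exists_cell (s := {b}) e.level_le (by simp) (by simp)
    have hv' := hv' hl₁ hl₂
    have hw' := hw' hl₁ hl₂
    refine ⟨v, w, ?_, fun c => ?_⟩
    · rintro rfl
      simp [hv', hab] at hw'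
    · rw [lt_iff, hs _ c.card_pos, StackCell.ext_iff, StackCell.ext_iff, hv, hw, hv', hw', h₁,
        ← and_or_left]
      simp
  · obtain ⟨hl₁, hl₂, hl₃⟩ := level_bounds hk (h₂.le.trans one_le_two)
    have hl₃ := hl₃ h₁
    obtain ⟨v, hv, -, hv'⟩ := exists_cell (k := k) (x := e.level - 1) (s := e.base) (by omega)
      (by omega) (by omega)
    obtain ⟨w, hw, -, hw'⟩ := exists_cell (k := k) (x := e.level + 1) (s := e.base) (by omega)
      (by omega) (by omega)
    have hv' := hv' (by omega) (by omega)
    have hw' := hw' (by omega) (by omega)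
    refine ⟨v, w, ?_, fun c => ?_⟩
    · rintro rfl
      omega
    · have h₃ : c.level + 1 = e.level ↔ c.level = e.level - 1 := by omega
      have h₄ : e.level + 1 = c.level ↔ c.level = e.level + 1 := by omega
      rw [lt_iff, base_subset_iff_eq h₂, StackCell.ext_iff, StackCell.ext_iff, hv, hw, hv', hw',
        h₃, h₄]
      simp [not_base_ssubset h₂, h₁, or_and_right]

lemma edge_faces (hk : Odd k) (e : StackCell k) (he : e.rank = 1) :
    ∃ f g, f ≠ g ∧ ∀ c, e < c ↔ c = f ∨ c = g := by
  rcases rank_eq_one.1 he with ⟨h₁, h₂⟩ | ⟨h₁, h₂⟩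
  · obtain ⟨hl₁, hl₂, -⟩ := level_bounds hk h₂.le
    have key : ∀ f c : StackCell k, f.level % 2 = 0 → e.base ⊆ f.base →
        (c.level = f.level ∧ e.base ⊆ c.base ↔ c = f) := by
      intro f c hf hef
      refine ⟨fun ⟨hl, hs⟩ => StackCell.ext hl ?_, by rintro rfl; exact ⟨rfl, hef⟩⟩
      have hc := c.card_eq_three
      have hf := f.card_eq_three
      rw [hl] at hc
      have := c.card_le
      have := f.card_le
      have := Finset.card_le_card hs
      have := Finset.card_le_card hef
      by_cases h : f.level = 0 ∨ f.level = k + 1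
      · rw [eq_univ (hc.2 h), eq_univ (hf.2 h)]
      · rw [← Finset.eq_of_subset_of_card_le hs (by omega),
          ← Finset.eq_of_subset_of_card_le hef (by omega)]
    obtain ⟨f, hf, hf', -⟩ := exists_cell (k := k) (x := e.level - 1) (s := e.base) (by omega)
      (by omega) (by omega)
    obtain ⟨g, hg, hg', -⟩ := exists_cell (k := k) (x := e.level + 1) (s := e.base) (by omega)
      (by omega) (by omega)
    refine ⟨f, g, by rintro rfl; omega, fun c => ?_⟩
    rw [← key f c (by omega) hf', ← key g c (by omega) hg', lt_iff, hf, hg]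
    have h₃ : ¬ (e.level = c.level ∧ e.base ⊂ c.base) := by
      rintro ⟨hl, hs⟩
      have := Finset.card_lt_card hs
      have := c.card_eq_three
      have := c.card_le
      omega
    have h₄ : c.level % 2 = 0 ∧ (e.level + 1 = c.level ∨ c.level + 1 = e.level) ↔
        c.level = e.level - 1 ∨ c.level = e.level + 1 := by omega
    rw [← and_assoc, h₄, ← or_and_right]
    simp [h₃]
  · obtain ⟨hl₁, hl₂, hl₃⟩ := level_bounds hk (h₂.le.trans one_le_two)
    obtain ⟨t, u, htu, ht, hu, -, -, hs⟩ := exists_pairs e.base h₂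
    obtain ⟨f, hf, -, hf'⟩ := exists_cell (s := t) e.level_le (by omega) (by omega)
    obtain ⟨g, hg, -, hg'⟩ := exists_cell (s := u) e.level_le (by omega) (by omega)
    have hf' := hf' hl₁ hl₂
    have hg' := hg' hl₁ hl₂
    refine ⟨f, g, ?_, fun c => ?_⟩
    · rintro rfl
      exact htu (hf'.symm.trans hg')
    · have h₃ : ¬ (c.level % 2 = 0 ∧ (e.level + 1 = c.level ∨ c.level + 1 = e.level) ∧
          e.base ⊆ c.base) := by omega
      rw [lt_iff, or_iff_left h₃, StackCell.ext_iff, StackCell.ext_iff, hf, hg, hf', hg',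
        ← and_or_left, eq_comm]
      refine and_congr_right fun hl => hs _ ?_
      have := c.card_le
      have := c.card_eq_three
      omega

lemma corner_edges (hk : Odd k) (v f : StackCell k) (hvf : v < f) (hv : v.rank = 0)
    (hf : f.rank = 2) : ∃ d e, d ≠ e ∧ ∀ c, v < c ∧ c < f ↔ c = d ∨ c = e := by
  obtain ⟨hv₁, hv₂⟩ := rank_eq_zero.1 hv
  obtain ⟨hf₁, hf₂⟩ := (rank_eq_two hk).1 hf
  obtain ⟨hl₁, hl₂, -⟩ := level_bounds hk (hv₂.le.trans one_le_two)
  have hlvl : v.level + 1 = f.level ∨ f.level + 1 = v.level := by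
    rcases lt_iff.1 hvf with h | h
    · omega
    · exact h.2.1
  have hsub := base_subset_of_lt hvf
  rcases hf₂ with hf₂ | hf₂
  · obtain ⟨hl₃, hl₄, -⟩ := level_bounds hk hf₂.le
    obtain ⟨d, hd, -, hd'⟩ := exists_cell (s := v.base) f.level_le (by omega) (by omega)
    obtain ⟨e, he, -, he'⟩ := exists_cell (s := f.base) v.level_le (by omega) (by omega)
    have hd' := hd' hl₃ hl₄
    have he' := he' hl₁ hl₂
    refine ⟨d, e, by rintro rfl; omega, fun c => ⟨fun ⟨h₁, h₂⟩ => ?_, ?_⟩⟩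
    · have hs₁ := base_subset_of_lt h₁
      have hs₂ := base_subset_of_lt h₂
      rcases lt_iff.1 h₂ with ⟨hl, hs⟩ | ⟨-, hl, -⟩
      · have := Finset.card_lt_card hs
        exact Or.inl (StackCell.ext (hl.trans hd.symm)
          ((Finset.eq_of_subset_of_card_le hs₁ (by omega)).symm.trans hd'.symm))
      · rcases lt_iff.1 h₁ with ⟨hl', hs⟩ | ⟨hl', -⟩
        · have := Finset.card_lt_card hs
          exact Or.inr (StackCell.ext (hl'.symm.trans he.symm)
            ((Finset.eq_of_subset_of_card_le hs₂ (by omega)).trans he'.symm))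
        · omega
    · have hss : v.base ⊂ f.base := hsub.ssubset_of_ne fun h => by rw [h] at hv₂; omega
      rintro (rfl | rfl)
      · exact ⟨lt_iff.2 (Or.inr ⟨by omega, by omega, hd'.symm.subset⟩),
          lt_iff.2 (Or.inl ⟨hd, hd' ▸ hss⟩)⟩
      · exact ⟨lt_iff.2 (Or.inl ⟨he.symm, he'.symm ▸ hss⟩),
          lt_iff.2 (Or.inr ⟨by omega, by omega, he'.subset⟩)⟩
  · obtain ⟨t, u, htu, ht, hu, hvt, hvu, hs⟩ := exists_pairs v.base hv₂
    obtain ⟨d, hd, -, hd'⟩ := exists_cell (s := t) v.level_le (by omega) (by omega)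
    obtain ⟨e, he, -, he'⟩ := exists_cell (s := u) v.level_le (by omega) (by omega)
    have hd' := hd' hl₁ hl₂
    have he' := he' hl₁ hl₂
    have hsf : ∀ s : Finset (Fin 3), s ⊆ f.base := fun s => eq_univ hf₂ ▸ s.subset_univ
    refine ⟨d, e, by rintro rfl; exact htu (hd'.symm.trans he'), fun c => ⟨fun ⟨h₁, h₂⟩ => ?_, ?_⟩⟩
    · have hl : v.level = c.level := by
        rcases lt_iff.1 h₁ with h | ⟨h, h', -⟩
        · exact h.1
        · exfalso
          have := f.card_eq_three
          have := c.card_eq_three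
          rcases lt_iff.1 h₂ with ⟨hl, hss⟩ | ⟨-, hl, -⟩
          · have := Finset.card_lt_card hss
            omega
          · omega
      have hc := (hs c.base (by have := c.card_le; have := c.card_eq_three; omega)).1
        ((lt_iff.1 h₁).resolve_right (by omega)).2
      rw [StackCell.ext_iff, StackCell.ext_iff, hd, he, hd', he', ← and_or_left]
      exact ⟨hl.symm, hc⟩
    · rintro (rfl | rfl)
      · exact ⟨lt_iff.2 (Or.inl ⟨hd.symm, hd'.symm ▸ hvt⟩),
          lt_iff.2 (Or.inr ⟨by omega, by omega, hsf _⟩)⟩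
      · exact ⟨lt_iff.2 (Or.inl ⟨he.symm, he'.symm ▸ hvu⟩),
          lt_iff.2 (Or.inr ⟨by omega, by omega, hsf _⟩)⟩

lemma exists_inner_cell {x : ℕ} {s : Finset (Fin 3)} (hx₁ : 1 ≤ x) (hx₂ : x ≤ k)
    (h₁ : 1 ≤ s.card) (h₂ : s.card ≤ 2) : ∃ c : StackCell k, c.level = x ∧ c.base = s := by
  obtain ⟨c, hc, -, hc'⟩ := exists_cell (k := k) (x := x) (by omega) h₁ h₂
  exact ⟨c, hc, hc' hx₁ hx₂⟩

lemma le_of_adjacent {c d : StackCell k} (hd : d.level % 2 = 0)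
    (hl : c.level = d.level ∨ c.level + 1 = d.level ∨ d.level + 1 = c.level)
    (hs : c.base ⊆ d.base) : c ≤ d := ⟨by omega, hs⟩

lemma le_of_level_eq {c d : StackCell k} (hl : c.level = d.level) (hs : c.base ⊆ d.base) : c ≤ d :=
  ⟨Or.inl hl, hs⟩

lemma connected_below (hk : Odd k) (f : StackCell k) (hf : f.rank = 2) (c d : StackCell k)
    (hc : c < f) (hd : d < f) : Relation.ReflTransGen (ComparableIn (Set.Iio f)) c d := by
  obtain ⟨hf₁, hf₂⟩ := (rank_eq_two hk).1 hf
  suffices ∃ p, ∀ c < f, Relation.ReflTransGen (ComparableIn (Set.Iio f)) c p by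
    obtain ⟨p, hp⟩ := this
    exact (hp c hc).trans (ComparableIn.reflTransGen_symm (hp d hd))
  rcases hf₂ with hf₂ | hf₂
  · obtain ⟨hl₁, hl₂, hl₃⟩ := level_bounds hk hf₂.le
    have hl₃ := hl₃ hf₁
    obtain ⟨p, hp, hp'⟩ := exists_inner_cell (k := k) (x := f.level - 1) (s := f.base) (by omega)
      (by omega) (by omega) (by omega)
    refine ⟨p, fun c hc => ?_⟩
    obtain ⟨a, ha⟩ := Finset.card_pos.1 c.card_pos
    have haf : {a} ⊆ f.base := Finset.singleton_subset_iff.2 (base_subset_of_lt hc ha)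
    have hss : {a} ⊂ f.base := haf.ssubset_of_ne fun h => by rw [← h] at hf₂; simp at hf₂
    have hcl : c.level = f.level ∨ c.level + 1 = f.level ∨ f.level + 1 = c.level := by
      rcases lt_iff.1 hc with h | h
      · exact Or.inl h.1
      · exact Or.inr h.2.1
    obtain ⟨c', hc₁, hc₂⟩ := exists_inner_cell (k := k) (x := c.level) (s := {a}) (by omega)
      (by omega) (by simp) (by simp)
    obtain ⟨z, hz₁, hz₂⟩ := exists_inner_cell (s := {a}) hl₁ hl₂ (by simp) (by simp)
    obtain ⟨w, hw₁, hw₂⟩ := exists_inner_cell (k := k) (x := f.level - 1) (s := {a}) (by omega)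
      (by omega) (by simp) (by simp)
    have hcc : c' ≤ c := le_of_level_eq hc₁ (by simpa [hc₂] using ha)
    have hzf : z < f := lt_iff.2 (Or.inl ⟨hz₁, hz₂ ▸ hss⟩)
    have hcz : c' ≤ z := le_of_adjacent (by omega) (by omega) (by rw [hc₂, hz₂])
    have hwz : w ≤ z := le_of_adjacent (by omega) (by omega) (by rw [hw₂, hz₂])
    have hwp : w ≤ p := le_of_level_eq (by omega) (by rw [hw₂, hp']; exact haf)
    have hpf : p < f := lt_iff.2 (Or.inr ⟨hf₁, by omega, hp'.subset⟩)
    exact .head ⟨hc, hcc.trans_lt hc, Or.inr hcc⟩ <| .head ⟨hcc.trans_lt hc, hzf, Or.inl hcz⟩ <|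
      .head ⟨hzf, hwz.trans_lt hzf, Or.inr hwz⟩ <| .single ⟨hwz.trans_lt hzf, hpf, Or.inl hwp⟩
  · have hk' := Nat.odd_iff.1 hk
    have hf₃ := f.card_eq_three.1 hf₂
    have below : ∀ c : StackCell k, c.level + 1 = f.level ∨ f.level + 1 = c.level → c < f :=
      fun c hc => lt_iff.2 (Or.inr ⟨hf₁, hc, eq_univ hf₂ ▸ c.base.subset_univ⟩)
    have hl : ∃ y, 1 ≤ y ∧ y ≤ k ∧ ∀ c : StackCell k, c < f ↔ c.level = y := by
      refine ⟨if f.level = 0 then 1 else k, by split <;> omega, by split <;> omega, fun c => ?_⟩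
      refine ⟨fun hc => ?_, fun hc => below c (by split at hc <;> omega)⟩
      have := c.level_le
      have := c.card_eq_three
      rcases lt_iff.1 hc with ⟨h, hs⟩ | ⟨-, h, -⟩
      · have := Finset.card_lt_card hs
        omega
      · split <;> omega
    obtain ⟨y, hy₁, hy₂, hy⟩ := hl
    obtain ⟨p, hp, hp'⟩ := exists_inner_cell hy₁ hy₂ (s := {0}) (by simp) (by simp)
    refine ⟨p, fun c hc => ?_⟩
    obtain ⟨a, ha⟩ := Finset.card_pos.1 c.card_pos
    obtain ⟨c', hc₁, hc₂⟩ := exists_inner_cell hy₁ hy₂ (s := {a}) (by simp) (by simp)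
    obtain ⟨e, he₁, he₂⟩ := exists_inner_cell hy₁ hy₂ (s := {a, 0}) (Finset.card_pos.2 (by simp))
      Finset.card_le_two
    have hcl := (hy c).1 hc
    exact .head ⟨hc, (hy c').2 hc₁, Or.inr (le_of_level_eq (by omega) (by simpa [hc₂] using ha))⟩ <|
      .head ⟨(hy c').2 hc₁, (hy e).2 he₁,
        Or.inl (le_of_level_eq (by omega) (by simp [hc₂, he₂]))⟩ <|
      .single ⟨(hy e).2 he₁, (hy p).2 hp, Or.inr (le_of_level_eq (by omega) (by simp [hp', he₂]))⟩

lemma connected_above (hk : Odd k) (v : StackCell k) (hv : v.rank = 0) (c d : StackCell k)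
    (hc : v < c) (hd : v < d) : Relation.ReflTransGen (ComparableIn (Set.Ioi v)) c d := by
  obtain ⟨hv₁, hv₂⟩ := rank_eq_zero.1 hv
  obtain ⟨hl₁, hl₂, -⟩ := level_bounds hk (hv₂.le.trans one_le_two)
  obtain ⟨t, -, -, ht, -, hvt, -⟩ := exists_pairs v.base hv₂
  obtain ⟨p, hp, hp'⟩ := exists_inner_cell hl₁ hl₂ (s := t) (by omega) (by omega)
  have hvp : v < p := lt_iff.2 (Or.inl ⟨hp.symm, hp'.symm ▸ hvt⟩)
  have side : ∀ c, v < c → c.level ≠ v.level →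
      Relation.ReflTransGen (ComparableIn (Set.Ioi v)) c p := by
    intro c hc hcl
    have hcl' := (lt_iff.1 hc).resolve_left (fun h => hcl h.1.symm)
    by_cases hcard : c.base.card = 3
    · exact .single ⟨hc, hvp, Or.inr (le_of_adjacent hcl'.1 (by omega)
        (eq_univ hcard ▸ p.base.subset_univ))⟩
    · have := c.level_le
      have := c.card_eq_three
      obtain ⟨c', hc₁, hc₂⟩ := exists_inner_cell (k := k) (x := c.level) (s := v.base) (by omega)
        (by omega) (by omega) (by omega)
      obtain ⟨z, hz₁, hz₂⟩ := exists_inner_cell (k := k) (x := c.level) (s := t) (by omega)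
        (by omega) (by omega) (by omega)
      have hvc : v < c' := lt_iff.2 (Or.inr ⟨by omega, by omega, hc₂.symm.subset⟩)
      have hcz : c' ≤ z := le_of_level_eq (by omega) (by rw [hc₂, hz₂]; exact hvt.subset)
      have hpz : p ≤ z := le_of_adjacent (by omega) (by omega) (by rw [hp', hz₂])
      have hcc : c' ≤ c := le_of_level_eq hc₁ (by rw [hc₂]; exact hcl'.2.2)
      exact .head ⟨hc, hvc, Or.inr hcc⟩ <| .head ⟨hvc, hvc.trans_le hcz, Or.inl hcz⟩ <|
        .single ⟨hvc.trans_le hcz, hvp, Or.inr hpz⟩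
  have all : ∀ c, v < c → Relation.ReflTransGen (ComparableIn (Set.Ioi v)) c p := by
    intro c hc
    by_cases hcl : c.level = v.level
    · have := c.card_eq_three
      have := c.card_le
      obtain ⟨g, hg, hg', -⟩ := exists_cell (k := k) (x := c.level + 1) (s := c.base) (by omega)
        c.card_pos (by omega)
      have hcg : c ≤ g := le_of_adjacent (by omega) (by omega) hg'
      exact .head ⟨hc, hc.trans_le hcg, Or.inl hcg⟩ (side g (hc.trans_le hcg) (by omega))
    · exact side c hc hcl
  exact (all c hc).trans (ComparableIn.reflTransGen_symm (all d hd))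

lemma connected (hk : Odd k) (c d : StackCell k) :
    Relation.ReflTransGen (ComparableIn Set.univ) c d := by
  have hk' := Nat.odd_iff.1 hk
  have of_le : ∀ {c d : StackCell k}, c ≤ d →
      Relation.ReflTransGen (ComparableIn Set.univ) c d ∧
      Relation.ReflTransGen (ComparableIn Set.univ) d c := fun h =>
    ⟨.single ⟨trivial, trivial, Or.inl h⟩, .single ⟨trivial, trivial, Or.inr h⟩⟩
  have vertical : ∀ (a : Fin 3) (p : StackCell k), p.level = 1 → p.base = {a} → ∀ n, 1 ≤ n →
      ∀ c : StackCell k, c.level = n → c.base = {a} →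
      Relation.ReflTransGen (ComparableIn Set.univ) c p := by
    intro a p hp hp' n hn
    induction n, hn using Nat.le_induction with
    | base =>
      intro c hc hc'
      exact (of_le (le_of_level_eq (hc.trans hp.symm) (by rw [hc', hp']))).1
    | succ n hn ih =>
      intro c hc hc'
      have := c.level_le
      have := c.card_eq_three
      have hcard : c.base.card = 1 := by rw [hc']; simp
      obtain ⟨w, hw, hw'⟩ := exists_inner_cell (k := k) (x := n) (s := {a}) hn (by omega) (by simp)
        (by simp)
      refine .trans ?_ (ih w hw hw')
      rcases Nat.mod_two_eq_zero_or_one n with h | h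
      · exact (of_le (le_of_adjacent (by omega) (by omega) (by rw [hc', hw']))).1
      · exact (of_le (le_of_adjacent (by omega) (by omega) (by rw [hc', hw']))).2
  obtain ⟨p, hp, hp'⟩ := exists_inner_cell (k := k) (x := 1) (s := {0}) le_rfl (by omega) (by simp)
    (by simp)
  have all : ∀ c : StackCell k, Relation.ReflTransGen (ComparableIn Set.univ) c p := by
    intro c
    obtain ⟨a, ha⟩ := Finset.card_pos.1 c.card_pos
    have := c.level_le
    obtain ⟨c', hc₁, hc₂⟩ := exists_inner_cell (k := k) (x := max 1 (min k c.level)) (s := {a})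
      (by omega) (by omega) (by simp) (by simp)
    obtain ⟨q, hq₁, hq₂⟩ := exists_inner_cell (k := k) (x := 1) (s := {a}) le_rfl (by omega)
      (by simp) (by simp)
    obtain ⟨e, he₁, he₂⟩ := exists_inner_cell (k := k) (x := 1) (s := {a, 0}) le_rfl (by omega)
      (Finset.card_pos.2 (by simp)) Finset.card_le_two
    have hcc : c' ≤ c := ⟨by omega, by simpa [hc₂] using ha⟩
    exact (of_le hcc).2.trans <| (vertical a q hq₁ hq₂ _ (by omega) c' hc₁ hc₂).trans <|
      (of_le (le_of_level_eq (hq₁.trans he₁.symm) (by simp [hq₂, he₂]))).1.trans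
        (of_le (le_of_level_eq (hp.trans he₁.symm) (by simp [hp', he₂]))).2
  exact (all c).trans (ComparableIn.reflTransGen_symm (all d))

lemma isPolyhedral (hk : Odd k) : IsPolyhedral (rank (k := k)) where
  nonempty := ⟨⟨0, Finset.univ, by omega, by simp, by simp⟩⟩
  strictMono := rank_strictMono hk
  nonneg c := by rcases rank_cases hk c with h | h | h <;> omega
  le_two c := by rcases rank_cases hk c with h | h | h <;> omega
  exists_lt c hc := by
    rcases rank_cases hk c with h | h | h
    · omega
    · obtain ⟨v, w, -, hvw⟩ := edge_vertices hk c h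
      exact ⟨v, (hvw v).2 (Or.inl rfl)⟩
    · obtain ⟨h₁, h₂⟩ := (rank_eq_two hk).1 h
      have := c.level_le
      have := c.card_eq_three
      have := Nat.odd_iff.1 hk
      obtain ⟨a, ha⟩ := Finset.card_pos.1 c.card_pos
      obtain ⟨d, hd, hd'⟩ := exists_inner_cell (k := k)
        (x := if c.level = 0 then 1 else c.level - 1) (s := {a}) (by split <;> omega)
        (by split <;> omega) (by simp) (by simp)
      exact ⟨d, lt_iff.2 (Or.inr ⟨h₁, by split at hd <;> omega, by simpa [hd'] using ha⟩)⟩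
  exists_gt c hc := by
    rcases rank_cases hk c with h | h | h
    · obtain ⟨h₁, h₂⟩ := rank_eq_zero.1 h
      obtain ⟨t, -, -, ht, -, hct, -⟩ := exists_pairs c.base h₂
      obtain ⟨hl₁, hl₂, -⟩ := level_bounds hk (h₂.le.trans one_le_two)
      obtain ⟨d, hd, hd'⟩ := exists_inner_cell hl₁ hl₂ (s := t) (by omega) (by omega)
      exact ⟨d, lt_iff.2 (Or.inl ⟨hd.symm, hd'.symm ▸ hct⟩)⟩
    · obtain ⟨f, g, -, hfg⟩ := edge_faces hk c h
      exact ⟨f, (hfg f).2 (Or.inl rfl)⟩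
    · omega
  edge_vertices := edge_vertices hk
  edge_faces := edge_faces hk
  corner_edges := corner_edges hk
  connected := connected hk
  connected_below := connected_below hk
  connected_above := connected_above hk

lemma flag_levels (hk : Odd k) (A : ProperFlag (StackCell k)) :
    A.vertex.level % 2 = 1 ∧ A.vertex.base.card = 1 ∧ 1 ≤ A.vertex.level ∧ A.vertex.level ≤ k ∧
    A.face.level % 2 = 0 ∧ A.face.level ≤ k + 1 ∧ 1 ≤ A.edge.level ∧ A.edge.level ≤ k ∧
    (A.edge.level % 2 = 1 ∧ A.edge.base.card = 2 ∧ A.vertex.level = A.edge.level ∧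
        (A.face.level + 1 = A.edge.level ∨ A.face.level = A.edge.level + 1) ∨
      A.edge.level % 2 = 0 ∧ A.edge.base.card = 1 ∧ A.face.level = A.edge.level ∧
        (A.vertex.level + 1 = A.edge.level ∨ A.vertex.level = A.edge.level + 1)) ∧
    (A.face.base.card = 3 ∧ (A.face.level = 0 ∨ A.face.level = k + 1) ∨
      A.face.base.card = 2 ∧ 2 ≤ A.face.level ∧ A.face.level + 1 ≤ k) := by
  obtain ⟨hv, he, hf⟩ := (isPolyhedral hk).rank_properFlag A
  have hv := rank_eq_zero.1 hv
  have he := rank_eq_one.1 he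
  have hf := (rank_eq_two hk).1 hf
  have := A.face.level_le
  have := level_bounds hk (hv.2.le.trans one_le_two)
  have := level_bounds hk (c := A.edge) (by omega)
  have := A.face.card_eq_three
  have h₁ := (le_iff.1 A.vertex_lt.le).1
  have h₂ := (le_iff.1 A.edge_lt.le).1
  have := Nat.odd_iff.1 hk
  have h₃ : A.edge.level % 2 = 0 → A.face.level = A.edge.level := by omega
  have h₄ : A.edge.level % 2 = 1 → A.vertex.level = A.edge.level := by omega
  refine ⟨by omega, by omega, by omega, by omega, by omega, by omega, by omega, by omega,
    by omega, by omega⟩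

/-- The position of a flag along the stack, from the cap at level `0` to that at level `k + 1`. -/
def position (A : ProperFlag (StackCell k)) : ℕ :=
  2 * (A.vertex.level + A.edge.level + A.face.level) / 3 - 1

lemma position_lt (hk : Odd k) (A : ProperFlag (StackCell k)) : position A < 2 * k := by
  have := flag_levels hk A
  unfold position
  omega

/-- The distance along the stack from a flag to the nearer cap. -/
def depth (A : ProperFlag (StackCell k)) : ℕ := min (position A) (2 * k - 1 - position A)

lemma depth_eq_zero (hk : Odd k) (A : ProperFlag (StackCell k)) :
    depth A = 0 ↔ A.face.base.card = 3 := by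
  have := flag_levels hk A
  unfold depth position
  omega

/-- Two flags are adjacent if they differ in at most one face. -/
def Adj {C : Type*} [PartialOrder C] (A B : ProperFlag C) : Prop :=
  A.edge = B.edge ∧ A.face = B.face ∨ A.vertex = B.vertex ∧ A.face = B.face ∨
    A.vertex = B.vertex ∧ A.edge = B.edge

lemma Adj.map {A B : ProperFlag (StackCell k)} (h : Adj A B) (τ : StackCell k ≃o StackCell k) :
    Adj (A.map τ) (B.map τ) := by
  simpa [Adj] using h

lemma Adj.position_le (hk : Odd k) {A B : ProperFlag (StackCell k)} (h : Adj A B) :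
    position B ≤ position A + 1 ∧ position A ≤ position B + 1 := by
  have hA := flag_levels hk A
  have hB := flag_levels hk B
  unfold position
  rcases h with ⟨h₁, h₂⟩ | ⟨h₁, h₂⟩ | ⟨h₁, h₂⟩ <;> rw [← h₁, ← h₂] at hB ⊢ <;> omega

lemma Adj.depth_le (hk : Odd k) {A B : ProperFlag (StackCell k)} (h : Adj A B) :
    depth A ≤ depth B + 1 := by
  have := h.position_le hk
  unfold depth
  omega

lemma exists_adj_edge (hk : Odd k) (A : ProperFlag (StackCell k)) (hA : A.face.base.card = 2) :
    ∃ B, Adj A B ∧ B.vertex.level = A.vertex.level ∧ B.face.level = A.face.level ∧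
      B.edge.level + A.edge.level = A.vertex.level + A.face.level := by
  obtain ⟨hv, hv', hl₁, hl₂, hf, hl₃, hl₄, hl₅, he, hf'⟩ := flag_levels hk A
  have hs := base_subset_of_lt (A.vertex_lt.trans A.edge_lt)
  have hss : A.vertex.base ⊂ A.face.base := hs.ssubset_of_ne fun h => by rw [h] at hv'; omega
  rcases he with ⟨he, -, hve, hfe⟩ | ⟨he, -, hfe, hve⟩
  · obtain ⟨e, he₁, he₂⟩ := exists_inner_cell (k := k) (x := A.face.level) (s := A.vertex.base)
      (by omega) (by omega) (by omega) (by omega)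
    exact ⟨⟨A.vertex, e, A.face, lt_iff.2 (Or.inr ⟨by omega, by omega, he₂.symm.subset⟩),
      lt_iff.2 (Or.inl ⟨he₁, he₂ ▸ hss⟩)⟩, Or.inr (Or.inl ⟨rfl, rfl⟩), rfl, rfl,
      by simp only [he₁]; omega⟩
  · obtain ⟨e, he₁, he₂⟩ := exists_inner_cell (k := k) (x := A.vertex.level) (s := A.face.base)
      (by omega) (by omega) (by omega) (by omega)
    exact ⟨⟨A.vertex, e, A.face, lt_iff.2 (Or.inl ⟨he₁.symm, he₂.symm ▸ hss⟩),
      lt_iff.2 (Or.inr ⟨by omega, by omega, he₂.subset⟩)⟩, Or.inr (Or.inl ⟨rfl, rfl⟩), rfl, rfl,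
      by simp only [he₁]; omega⟩

lemma exists_adj_of_edge (hk : Odd k) (A : ProperFlag (StackCell k)) :
    ∃ B, Adj A B ∧ B.edge.level = A.edge.level ∧
      A.vertex.level + B.vertex.level + (A.face.level + B.face.level) = 4 * A.edge.level := by
  obtain ⟨hv, hv', hl₁, hl₂, hf, hl₃, hl₄, hl₅, he, hf'⟩ := flag_levels hk A
  have hk' := Nat.odd_iff.1 hk
  rcases he with ⟨he, he', hve, hfe⟩ | ⟨he, he', hfe, hve⟩
  · obtain ⟨f, hf₁, hf₂, -⟩ := exists_cell (k := k) (x := 2 * A.edge.level - A.face.level)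
      (s := A.edge.base) (by omega) (by omega) (by omega)
    exact ⟨⟨A.vertex, A.edge, f, A.vertex_lt, lt_iff.2 (Or.inr ⟨by omega, by omega, hf₂⟩)⟩,
      Or.inr (Or.inr ⟨rfl, rfl⟩), rfl, by simp only [hf₁]; omega⟩
  · obtain ⟨v, hv₁, hv₂⟩ := exists_inner_cell (k := k) (x := 2 * A.edge.level - A.vertex.level)
      (s := A.edge.base) (by omega) (by omega) (by omega) (by omega)
    exact ⟨⟨v, A.edge, A.face, lt_iff.2 (Or.inr ⟨by omega, by omega, hv₂.subset⟩), A.edge_lt⟩,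
      Or.inl ⟨rfl, rfl⟩, rfl, by simp only [hv₁]; omega⟩

lemma position_edge (hk : Odd k) (A : ProperFlag (StackCell k)) : 1 ≤ A.edge.level ∧
    (A.vertex.level + A.face.level = 2 * A.edge.level + 1 ∧ position A + 1 = 2 * A.edge.level ∨
      A.vertex.level + A.face.level + 1 = 2 * A.edge.level ∧
        position A + 2 = 2 * A.edge.level) := by
  obtain ⟨-, -, -, -, -, -, h, -, he, -⟩ := flag_levels hk A
  have h' : A.vertex.level + A.face.level = 2 * A.edge.level + 1 ∨
      A.vertex.level + A.face.level + 1 = 2 * A.edge.level := by omega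
  unfold position
  omega

lemma position_of_face_card (hk : Odd k) (A : ProperFlag (StackCell k))
    (hA : A.face.base.card ≠ 2) : position A = 0 ∨ position A + 1 = 2 * k := by
  have := position_edge hk A
  obtain ⟨-, -, h₁, h₂, -, -, h₃, h₄, he, hf⟩ := flag_levels hk A
  have hf : A.face.level = 0 ∨ A.face.level = k + 1 := by omega
  omega

lemma exists_adj_position (hk : Odd k) (A : ProperFlag (StackCell k)) {n : ℕ} (hn : n < 2 * k)
    (hA : n + 1 = position A ∨ n = position A + 1) : ∃ B, Adj A B ∧ position B = n := by
  have hAp := position_edge hk A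
  obtain ⟨B, hAB, hB₁, hB₂⟩ := exists_adj_of_edge hk A
  have hBp := position_edge hk B
  by_cases hBn : position B = n
  · exact ⟨B, hAB, hBn⟩
  · by_cases hcard : A.face.base.card = 2
    · obtain ⟨B', hAB', hB'₁, hB'₂, hB'₃⟩ := exists_adj_edge hk A hcard
      have hBp' := position_edge hk B'
      exact ⟨B', hAB', by omega⟩
    · have := position_of_face_card hk A hcard
      have := position_lt hk B
      omega

lemma exists_adj_depth (hk : Odd k) (A : ProperFlag (StackCell k)) {n : ℕ}
    (hA : depth A = n + 1) : ∃ B, Adj A B ∧ depth B = n := by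
  have hlt := position_lt hk A
  unfold depth at hA ⊢
  rcases le_total (position A) (2 * k - 1 - position A) with h | h
  · obtain ⟨B, hAB, hB⟩ := exists_adj_position hk A (n := position A - 1) (by omega) (by omega)
    exact ⟨B, hAB, by omega⟩
  · obtain ⟨B, hAB, hB⟩ := exists_adj_position hk A (n := position A + 1) (by omega) (by omega)
    exact ⟨B, hAB, by omega⟩

lemma face_card_map (hk : Odd k) (A : ProperFlag (StackCell k)) (hA : A.face.base.card = 3)
    (τ : StackCell k ≃o StackCell k) : (A.map τ).face.base.card = 3 := by
  have hl := flag_levels hk (A.map τ)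
  by_contra hcard
  obtain ⟨a, b, hab, hs, -⟩ := exists_singletons (A.map τ).face.base (by omega)
  have inner : ∀ a ∈ (A.map τ).face.base, ∃ v e : StackCell k, v < e ∧ e < (A.map τ).face ∧
      e.base = {a} := by
    intro a ha
    obtain ⟨v, hv₁, hv₂⟩ := exists_inner_cell (k := k) (x := (A.map τ).face.level - 1) (s := {a})
      (by omega) (by omega) (by simp) (by simp)
    obtain ⟨e, he₁, he₂⟩ := exists_inner_cell (k := k) (x := (A.map τ).face.level) (s := {a})
      (by omega) (by omega) (by simp) (by simp)
    have hsub : {a} ⊆ (A.map τ).face.base := Finset.singleton_subset_iff.2 ha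
    have hss : {a} ⊂ (A.map τ).face.base := hsub.ssubset_of_ne fun h => hcard (by
      have : ({a} : Finset (Fin 3)).card = 1 := by simp
      rw [h] at this
      omega)
    exact ⟨v, e, lt_iff.2 (Or.inr ⟨by omega, by omega, by rw [hv₂, he₂]⟩),
      lt_iff.2 (Or.inl ⟨he₁, he₂ ▸ hss⟩), he₂⟩
  obtain ⟨v, e, hve, hef, he⟩ := inner a (by rw [hs]; simp)
  obtain ⟨v', e', hve', hef', he'⟩ := inner b (by rw [hs]; simp)
  let B : ProperFlag (StackCell k) := ⟨τ.symm v, τ.symm e, A.face, τ.symm.lt_iff_lt.2 hve,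
    by rw [τ.symm_apply_lt]; exact hef⟩
  let B' : ProperFlag (StackCell k) := ⟨τ.symm v', τ.symm e', A.face, τ.symm.lt_iff_lt.2 hve',
    by rw [τ.symm_apply_lt]; exact hef'⟩
  have hB := flag_levels hk B
  have hB' := flag_levels hk B'
  have hcell : ∃ w : StackCell k, w ≤ τ.symm e ∧ w ≤ τ.symm e' := by
    have hB : A.face.base.card = 3 → (τ.symm e).base.card = 2 ∧ 1 ≤ (τ.symm e).level ∧
        (τ.symm e).level ≤ k ∧ ((τ.symm e).level = 1 ∧ A.face.level = 0 ∨
          (τ.symm e).level = k ∧ A.face.level = k + 1) := by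
      simp only [B] at hB
      omega
    have hB' : A.face.base.card = 3 → (τ.symm e').base.card = 2 ∧
        ((τ.symm e').level = 1 ∧ A.face.level = 0 ∨
          (τ.symm e').level = k ∧ A.face.level = k + 1) := by
      simp only [B'] at hB'
      omega
    have hB := hB hA
    have hB' := hB' hA
    have hinter := Finset.card_inter_add_card_union (τ.symm e).base (τ.symm e').base
    have hunion := Finset.card_le_univ ((τ.symm e).base ∪ (τ.symm e').base)
    have hinter' := Finset.card_le_card
      (Finset.inter_subset_left (s₁ := (τ.symm e).base) (s₂ := (τ.symm e').base))
    rw [Fintype.card_fin] at hunion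
    obtain ⟨w, hw₁, hw₂⟩ := exists_inner_cell (k := k) (x := (τ.symm e).level)
      (s := (τ.symm e).base ∩ (τ.symm e').base) (by omega) (by omega) (by omega) (by omega)
    exact ⟨w, le_of_level_eq hw₁ (hw₂ ▸ Finset.inter_subset_left),
      le_of_level_eq (by omega) (hw₂ ▸ Finset.inter_subset_right)⟩
  obtain ⟨w, hw, hw'⟩ := hcell
  rw [OrderIso.le_symm_apply] at hw hw'
  obtain ⟨c, hc⟩ := Finset.card_pos.1 (τ w).card_pos
  have h₁ := hw.2 hc
  have h₂ := hw'.2 hc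
  rw [he, Finset.mem_singleton] at h₁
  rw [he', Finset.mem_singleton] at h₂
  exact hab (h₁.symm.trans h₂)

lemma depth_map_le (hk : Odd k) (τ : StackCell k ≃o StackCell k) (n : ℕ) :
    ∀ A : ProperFlag (StackCell k), depth A = n → depth (A.map τ) ≤ n := by
  induction n with
  | zero =>
    intro A hA
    exact ((depth_eq_zero hk _).2 (face_card_map hk A ((depth_eq_zero hk A).1 hA) τ)).le
  | succ n ih =>
    intro A hA
    obtain ⟨B, hAB, hB⟩ := exists_adj_depth hk A hA
    have hle := ih B hB
    have := (hAB.map τ).depth_le hk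
    omega

lemma depth_map (hk : Odd k) (A : ProperFlag (StackCell k)) (τ : StackCell k ≃o StackCell k) :
    depth (A.map τ) = depth A := by
  refine (depth_map_le hk τ _ A rfl).antisymm ?_
  have h := depth_map_le hk τ.symm _ (A.map τ) rfl
  have hA : (A.map τ).map τ.symm = A := ProperFlag.ext (by simp) (by simp) (by simp)
  rwa [hA] at h

lemma depth_lt (hk : Odd k) (A : ProperFlag (StackCell k)) : depth A < k := by
  have := position_lt hk A
  unfold depth
  omega

lemma exists_position (hk : Odd k) (n : ℕ) (hn : n < 2 * k) :
    ∃ A : ProperFlag (StackCell k), position A = n := by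
  induction n with
  | zero =>
    have hk' := Nat.odd_iff.1 hk
    obtain ⟨v, hv₁, hv₂⟩ := exists_inner_cell (k := k) (x := 1) (s := {0}) le_rfl (by omega)
      (by simp) (by simp)
    obtain ⟨e, he₁, he₂⟩ := exists_inner_cell (k := k) (x := 1) (s := {0, 1}) le_rfl (by omega)
      (by simp) (by simp)
    obtain ⟨f, hf₁, hf₂, -⟩ := exists_cell (k := k) (x := 0) (s := {0, 1}) (by omega)
      (by simp) (by simp)
    exact ⟨⟨v, e, f, lt_iff.2 (Or.inl ⟨by omega, by rw [hv₂, he₂]; decide⟩),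
      lt_iff.2 (Or.inr ⟨by omega, by omega, he₂ ▸ hf₂⟩)⟩, by simp [position, hv₁, he₁, hf₁]⟩
  | succ n ih =>
    obtain ⟨A, hA⟩ := ih (by omega)
    obtain ⟨B, -, hB⟩ := exists_adj_position hk A hn (by omega)
    exact ⟨B, hB⟩

lemma exists_depth (hk : Odd k) (n : ℕ) (hn : n < k) :
    ∃ A : ProperFlag (StackCell k), depth A = n := by
  obtain ⟨A, hA⟩ := exists_position hk n (by omega)
  exact ⟨A, by unfold depth; omega⟩

/-- The first `n` vertices of the triangle. -/
def std (n : ℕ) : Finset (Fin 3) := Finset.univ.filter (fun i => i.val < n)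

lemma exists_perm : ∀ s₃ : Finset (Fin 3), ∀ s₂ ∈ s₃.powerset, ∀ s₁ ∈ s₂.powerset,
    ∃ π : Equiv.Perm (Fin 3), (std s₁.card).map π.toEmbedding = s₁ ∧
      (std s₂.card).map π.toEmbedding = s₂ ∧ (std s₃.card).map π.toEmbedding = s₃ := by
  decide

/-- The automorphism of the stack permuting the vertices of the triangle. -/
def permute (π : Equiv.Perm (Fin 3)) : StackCell k ≃o StackCell k where
  toFun c := ⟨c.level, c.base.map π.toEmbedding, c.level_le, by simpa using c.card_pos,
    by simpa using c.card_eq_three⟩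
  invFun c := ⟨c.level, c.base.map π.symm.toEmbedding, c.level_le, by simpa using c.card_pos,
    by simpa using c.card_eq_three⟩
  left_inv c := by ext <;> simp
  right_inv c := by ext <;> simp
  map_rel_iff' := by simp [le_iff]

lemma exists_reflection (hk : Odd k) : ∃ ρ : StackCell k ≃o StackCell k,
    ∀ c, (ρ c).level + c.level = k + 1 ∧ (ρ c).base = c.base := by
  have hk' := Nat.odd_iff.1 hk
  let ρ : StackCell k → StackCell k := fun c => ⟨k + 1 - c.level, c.base, by omega, c.card_pos, by
    have := c.card_eq_three
    have := c.level_le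
    omega⟩
  have hρ : Function.Involutive ρ := fun c => StackCell.ext
    (by have := c.level_le; simp only [ρ]; omega) rfl
  refine ⟨⟨hρ.toPerm, ?_⟩, fun c => ⟨?_, rfl⟩⟩
  · intro c d
    have := c.level_le
    have := d.level_le
    rw [le_iff, le_iff]
    refine and_congr_left fun _ => ?_
    simp only [Function.Involutive.coe_toPerm, ρ]
    omega
  · have := c.level_le
    change k + 1 - c.level + c.level = k + 1
    omega

lemma exists_map_of_level_eq (hk : Odd k) (A B : ProperFlag (StackCell k))
    (hv : A.vertex.level = B.vertex.level) (he : A.edge.level = B.edge.level)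
    (hf : A.face.level = B.face.level) : ∃ τ, A.map τ = B := by
  have hA := flag_levels hk A
  have hB := flag_levels hk B
  obtain ⟨π, hπ₁, hπ₂, hπ₃⟩ := exists_perm A.face.base A.edge.base
    (Finset.mem_powerset.2 (base_subset_of_lt A.edge_lt)) A.vertex.base
    (Finset.mem_powerset.2 (base_subset_of_lt A.vertex_lt))
  obtain ⟨π', hπ'₁, hπ'₂, hπ'₃⟩ := exists_perm B.face.base B.edge.base
    (Finset.mem_powerset.2 (base_subset_of_lt B.edge_lt)) B.vertex.base
    (Finset.mem_powerset.2 (base_subset_of_lt B.vertex_lt))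
  have hcv : A.vertex.base.card = B.vertex.base.card := by omega
  have hce : A.edge.base.card = B.edge.base.card := by omega
  have hcf : A.face.base.card = B.face.base.card := by omega
  have key : ∀ s t : Finset (Fin 3), (std s.card).map π.toEmbedding = s →
      (std t.card).map π'.toEmbedding = t → s.card = t.card →
      s.map (π.symm.trans π').toEmbedding = t := by
    intro s t hs ht hst
    rw [← ht, ← hst]
    nth_rewrite 1 [← hs]
    rw [Finset.map_map]
    congr 1
    ext i
    simp
  exact ⟨permute (π.symm.trans π'), ProperFlag.ext (StackCell.ext hv (key _ _ hπ₁ hπ'₁ hcv))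
    (StackCell.ext he (key _ _ hπ₂ hπ'₂ hce)) (StackCell.ext hf (key _ _ hπ₃ hπ'₃ hcf))⟩

lemma exists_map_of_position_eq (hk : Odd k) (A B : ProperFlag (StackCell k))
    (h : position A = position B) : ∃ τ, A.map τ = B := by
  have hA := flag_levels hk A
  have hB := flag_levels hk B
  unfold position at h
  have he : A.edge.level = B.edge.level := by omega
  exact exists_map_of_level_eq hk A B (by omega) he (by omega)

lemma exists_map (hk : Odd k) (A B : ProperFlag (StackCell k)) (h : depth A = depth B) :
    ∃ τ, A.map τ = B := by
  have hA := position_lt hk A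
  have hB := position_lt hk B
  obtain ⟨ρ, hρ⟩ := exists_reflection hk
  by_cases hAB : position A = position B
  · exact exists_map_of_position_eq hk A B hAB
  · have hpos : position (A.map ρ) = position B := by
      have h₁ := hρ A.vertex
      have h₂ := hρ A.edge
      have h₃ := hρ A.face
      have hl := flag_levels hk A
      have : position (A.map ρ) + position A + 1 = 2 * k := by
        simp only [position, ProperFlag.map_vertex, ProperFlag.map_edge, ProperFlag.map_face]
        omega
      unfold depth at h
      omega
    obtain ⟨τ, hτ⟩ := exists_map_of_position_eq hk _ B hpos
    exact ⟨ρ.trans τ, hτ⟩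

lemma exists_three_vertices (hk : Odd k) (f : StackCell k) (hf : f.rank = 2) :
    ∃ a b c : StackCell k, a ≠ b ∧ a ≠ c ∧ b ≠ c ∧
      (a.rank = 0 ∧ a < f) ∧ (b.rank = 0 ∧ b < f) ∧ (c.rank = 0 ∧ c < f) := by
  obtain ⟨hf₁, hf₂⟩ := (rank_eq_two hk).1 hf
  have hk' := Nat.odd_iff.1 hk
  have hle := f.level_le
  have hthree := f.card_eq_three
  have vertex : ∀ (x : ℕ) (i : Fin 3), 1 ≤ x → x ≤ k → x + 1 = f.level ∨ f.level + 1 = x →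
      i ∈ f.base → ∃ a : StackCell k, a.level = x ∧ a.base = {i} ∧ a.rank = 0 ∧ a < f := by
    intro x i hx₁ hx₂ hx hi
    obtain ⟨a, ha₁, ha₂⟩ := exists_inner_cell hx₁ hx₂ (s := {i}) (by simp) (by simp)
    exact ⟨a, ha₁, ha₂, rank_eq_zero.2 ⟨by omega, by simp [ha₂]⟩,
      lt_iff.2 (Or.inr ⟨hf₁, by omega, by simpa [ha₂] using hi⟩)⟩
  rcases hf₂ with hf₂ | hf₂
  · obtain ⟨i, j, hij, hs, -⟩ := exists_singletons f.base hf₂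
    obtain ⟨a, ha, ha', hra, haf⟩ := vertex (f.level - 1) i (by omega) (by omega) (by omega)
      (by simp [hs])
    obtain ⟨b, hb, hb', hrb, hbf⟩ := vertex (f.level - 1) j (by omega) (by omega) (by omega)
      (by simp [hs])
    obtain ⟨c, hc, hc', hrc, hcf⟩ := vertex (f.level + 1) i (by omega) (by omega) (by omega)
      (by simp [hs])
    refine ⟨a, b, c, ?_, by rintro rfl; omega, by rintro rfl; omega, ⟨hra, haf⟩, ⟨hrb, hbf⟩,
      ⟨hrc, hcf⟩⟩
    rintro rfl
    simp [ha', hij] at hb'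
  · have hu := eq_univ hf₂
    obtain ⟨x, hx₁, hx₂, hx⟩ : ∃ x, 1 ≤ x ∧ x ≤ k ∧ (x + 1 = f.level ∨ f.level + 1 = x) := by
      rcases hthree.1 hf₂ with h | h
      · exact ⟨1, by omega, by omega, by omega⟩
      · exact ⟨k, by omega, by omega, by omega⟩
    obtain ⟨a, -, ha, hra, haf⟩ := vertex x 0 hx₁ hx₂ hx (by simp [hu])
    obtain ⟨b, -, hb, hrb, hbf⟩ := vertex x 1 hx₁ hx₂ hx (by simp [hu])
    obtain ⟨c, -, hc, hrc, hcf⟩ := vertex x 2 hx₁ hx₂ hx (by simp [hu])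
    refine ⟨a, b, c, ?_, ?_, ?_, ⟨hra, haf⟩, ⟨hrb, hbf⟩, ⟨hrc, hcf⟩⟩
    · rintro rfl
      simp [ha] at hb
    · rintro rfl
      simp [ha] at hc
    · rintro rfl
      simp [hb] at hc

lemma exists_three_edges (hk : Odd k) (hk₃ : 3 ≤ k) (v : StackCell k) (hv : v.rank = 0) :
    ∃ a b c : StackCell k, a ≠ b ∧ a ≠ c ∧ b ≠ c ∧
      (a.rank = 1 ∧ v < a) ∧ (b.rank = 1 ∧ v < b) ∧ (c.rank = 1 ∧ v < c) := by
  obtain ⟨hv₁, hv₂⟩ := rank_eq_zero.1 hv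
  obtain ⟨hl₁, hl₂, -⟩ := level_bounds hk (hv₂.le.trans one_le_two)
  have hk' := Nat.odd_iff.1 hk
  obtain ⟨t, u, htu, ht, hu, hvt, hvu, -⟩ := exists_pairs v.base hv₂
  obtain ⟨a, ha, ha'⟩ := exists_inner_cell hl₁ hl₂ (s := t) (by omega) (by omega)
  obtain ⟨b, hb, hb'⟩ := exists_inner_cell hl₁ hl₂ (s := u) (by omega) (by omega)
  obtain ⟨x, hx₁, hx₂, hx⟩ : ∃ x, 1 ≤ x ∧ x ≤ k ∧ (v.level + 1 = x ∨ x + 1 = v.level) := by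
    by_cases h : v.level = 1
    · exact ⟨2, by omega, by omega, by omega⟩
    · exact ⟨v.level - 1, by omega, by omega, by omega⟩
  obtain ⟨c, hc, hc'⟩ := exists_inner_cell hx₁ hx₂ (s := v.base) (by omega) (by omega)
  refine ⟨a, b, c, ?_, by rintro rfl; omega, by rintro rfl; omega,
    ⟨rank_eq_one.2 (by rw [ha']; omega), lt_iff.2 (Or.inl ⟨ha.symm, ha'.symm ▸ hvt⟩)⟩,
    ⟨rank_eq_one.2 (by rw [hb']; omega), lt_iff.2 (Or.inl ⟨hb.symm, hb'.symm ▸ hvu⟩)⟩,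
    ⟨rank_eq_one.2 (by rw [hc']; omega),
      lt_iff.2 (Or.inr ⟨by omega, by omega, hc'.symm.subset⟩)⟩⟩
  rintro rfl
  exact htu (ha'.symm.trans hb')

end StackCell

/-- For every odd `k ≥ 5` there is a finite abstract polytope of rank `3` whose automorphism
group has exactly `k` orbits on flags, and in which no rank-2 section is a digon:  whenever
`F < G` with `rk G = rk F + 3`, there are at least three faces of rank `rk F + 1` strictly
between `F` and `G`. -/
theorem exists_k_orbit_polyhedron_no_digon (k : ℕ) (hk : 5 ≤ k) (hodd : Odd k) :
    ∃ (P : Type) (_ : PartialOrder P) (rk : P → ℤ),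
      Finite P ∧ IsAbstractPolytope 3 P rk ∧
      Nat.card (Quot (flagOrbitRel P)) = k ∧
      ∀ F G : P, F < G → rk G = rk F + 3 →
        ∃ H₁ H₂ H₃ : P, H₁ ≠ H₂ ∧ H₁ ≠ H₃ ∧ H₂ ≠ H₃ ∧
          (rk H₁ = rk F + 1 ∧ F < H₁ ∧ H₁ < G) ∧
          (rk H₂ = rk F + 1 ∧ F < H₂ ∧ H₂ < G) ∧
          (rk H₃ = rk F + 1 ∧ F < H₃ ∧ H₃ < G) := by
  have h := StackCell.isPolyhedral hodd
  refine ⟨WithBot (WithTop (StackCell k)), inferInstance, extRank StackCell.rank,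
    inferInstanceAs (Finite (Option (Option (StackCell k)))), h.isAbstractPolytope,
    h.card_flagOrbit k StackCell.depth (StackCell.depth_map hodd) (StackCell.exists_map hodd)
      (StackCell.depth_lt hodd) (StackCell.exists_depth hodd), fun F G hFG hr => ?_⟩
  rcases IsPolyhedral.face_cases F with rfl | rfl | ⟨v, rfl⟩ <;>
    rcases IsPolyhedral.face_cases G with rfl | rfl | ⟨f, rfl⟩
  · simp at hFG
  · simp at hr
  · obtain ⟨a, b, c, hab, hac, hbc, ha, hb, hc⟩ := StackCell.exists_three_vertices hodd f
      (by simp at hr; omega)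
    exact ⟨((a : WithTop (StackCell k)) : WithBot (WithTop (StackCell k))),
      ((b : WithTop (StackCell k)) : WithBot (WithTop (StackCell k))),
      ((c : WithTop (StackCell k)) : WithBot (WithTop (StackCell k))),
      by simpa using hab, by simpa using hac, by simpa using hbc,
      by simpa using ha, by simpa using hb, by simpa using hc⟩
  · simp at hFG
  · simp at hFG
  · simp at hr
    have := h.le_two f
    omega
  · simp at hFG
  · obtain ⟨a, b, c, hab, hac, hbc, ha, hb, hc⟩ := StackCell.exists_three_edges hodd (by omega) v
      (by simp at hr; omega)
    have hv : v.rank = 0 := by simp at hr; omega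
    exact ⟨((a : WithTop (StackCell k)) : WithBot (WithTop (StackCell k))),
      ((b : WithTop (StackCell k)) : WithBot (WithTop (StackCell k))),
      ((c : WithTop (StackCell k)) : WithBot (WithTop (StackCell k))),
      by simpa using hab, by simpa using hac, by simpa using hbc,
      by simpa [hv] using ha, by simpa [hv] using hb, by simpa [hv] using hc⟩
  · simp only [IsPolyhedral.extRank_coe] at hr
    have := h.nonneg v
    have := h.le_two f
    omega
end
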